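/- For every m > 0, κ > 0 and every multi-index I ∈ ℕ³ there exist functions h_{IJ} ∈ S⁰, indexed by multi-indices J with |J| ≤ |I|, such that for every smooth function v: (0,∞)×ℝ² → ℝ and all τ > 0, z ∈ ℝ²: [P_m, Γ^I]v(τ,z) = τ⁻² Σ_{|J|≤|I|} h_{IJ}(z) (Γ^J v)(τ,z), where [P_m, Γ^I]v = P_m(Γ^I v) − Γ^I(P_m v). -/

import Mathlib

open Real MeasureTheory Filter Set
noncomputable section

/-- Euclidean norm of a point of `ℝ²`. -/
def znorm (z : Fin 2 → ℝ) : ℝ := Real.sqrt (z 0 ^ 2 + z 1 ^ 2)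

/-- The Japanese bracket `⟨z⟩ = √(1 + |z|²)`. -/
def zjap (z : Fin 2 → ℝ) : ℝ := Real.sqrt (1 + (z 0 ^ 2 + z 1 ^ 2))

/-- `sinh r / r`, extended by `1` at `r = 0`. -/
def sinhc (r : ℝ) : ℝ := if r = 0 then 1 else Real.sinh r / r

/-- `G(z) = (sinh |z| / |z|)²`, extended by `G(0) = 1`. -/
def Gfun (z : Fin 2 → ℝ) : ℝ := sinhc (znorm z) ^ 2

/-- The matrix `M(z) = [[z₂², −z₁z₂],[−z₁z₂, z₁²]]` (indices `0,1`). -/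
def Mmat (z : Fin 2 → ℝ) (j k : Fin 2) : ℝ :=
  if j = 0 then (if k = 0 then z 1 ^ 2 else -(z 0 * z 1))
  else (if k = 0 then -(z 0 * z 1) else z 0 ^ 2)

/-- `g^{jk}(z) = δ_{jk} − (1/|z|² − 1/sinh²|z|) M_{jk}(z)`, extended by `g(0) = Id`. -/
def gmat (z : Fin 2 → ℝ) (j k : Fin 2) : ℝ :=
  if znorm z = 0 then (if j = k then 1 else 0)
  else (if j = k then 1 else 0)
    - (1 / znorm z ^ 2 - 1 / Real.sinh (znorm z) ^ 2) * Mmat z j k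

/-- Partial derivative `∂_{z_k}` of a function on `ℝ²`. -/
def pd (k : Fin 2) (f : (Fin 2 → ℝ) → ℝ) (z : Fin 2 → ℝ) : ℝ :=
  fderiv ℝ f z (Pi.single k 1)

/-- `Λ₀ v = G(z)^{−1/2} Σ_{i,j} ∂_{z_i}(G(z)^{1/2} g^{ij}(z) ∂_{z_j} v)`. -/
def Lam0 (v : (Fin 2 → ℝ) → ℝ) (z : Fin 2 → ℝ) : ℝ :=
  (Real.sqrt (Gfun z))⁻¹ *
    ∑ i, pd i (fun w => Real.sqrt (Gfun w) * ∑ j, gmat w i j * pd j v w) z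

/-- `Λ v = e^{κ⟨z⟩} Λ₀ (e^{−κ⟨z⟩} v)`. -/
def Lam (κ : ℝ) (v : (Fin 2 → ℝ) → ℝ) (z : Fin 2 → ℝ) : ℝ :=
  Real.exp (κ * zjap z) * Lam0 (fun w => Real.exp (-(κ * zjap w)) * v w) z

/-- `P_m v = ∂_τ² v − τ⁻² Λ v + m² v`. -/
def Pm (m κ : ℝ) (v : ℝ → (Fin 2 → ℝ) → ℝ) (τ : ℝ) (z : Fin 2 → ℝ) : ℝ :=
  iteratedDeriv 2 (fun s => v s z) τ - (1 / τ ^ 2) * Lam κ (v τ) z + m ^ 2 * v τ z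

/-- Coefficient matrix `c(z) = zzᵀ/|z|² + (|z|/tanh|z|)(Id − zzᵀ/|z|²)`, `c(0) = Id`. -/
def cmat (z : Fin 2 → ℝ) (j k : Fin 2) : ℝ :=
  if znorm z = 0 then (if j = k then 1 else 0)
  else z j * z k / znorm z ^ 2
    + (znorm z / Real.tanh (znorm z)) * ((if j = k then 1 else 0) - z j * z k / znorm z ^ 2)

/-- The vector fields `Γ₁, Γ₂, Γ₃` (indices `0,1,2`). -/
def GammaOp (j : Fin 3) (φ : (Fin 2 → ℝ) → ℝ) (z : Fin 2 → ℝ) : ℝ :=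
  if j = 0 then ∑ k, cmat z 0 k * pd k φ z
  else if j = 1 then ∑ k, cmat z 1 k * pd k φ z
  else z 0 * pd 1 φ z - z 1 * pd 0 φ z

/-- `Γ^I = Γ₁^{I₁} Γ₂^{I₂} Γ₃^{I₃}` for a multi-index `I`. -/
def GammaI (I : ℕ × ℕ × ℕ) (φ : (Fin 2 → ℝ) → ℝ) : (Fin 2 → ℝ) → ℝ :=
  (GammaOp 0)^[I.1] ((GammaOp 1)^[I.2.1] ((GammaOp 2)^[I.2.2] φ))

/-- The multi-indices `I ∈ ℕ³` with `|I| ≤ s`. -/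
def multiIndices (s : ℕ) : Finset (ℕ × ℕ × ℕ) :=
  (Finset.range (s+1) ×ˢ Finset.range (s+1) ×ˢ Finset.range (s+1)).filter
    (fun I => I.1 + I.2.1 + I.2.2 ≤ s)

/-- `‖φ‖_{(s)} = Σ_{|I|≤s} ‖Γ^I φ‖_{L²(ℝ², √G(z) dz)}`. -/
def sNorm (s : ℕ) (φ : (Fin 2 → ℝ) → ℝ) : ℝ :=
  ∑ I ∈ multiIndices s,
    Real.sqrt (∫ z : Fin 2 → ℝ, (GammaI I φ z) ^ 2 * Real.sqrt (Gfun z))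

/-- The energy `E_s(τ; v, m)`. -/
def energy (s : ℕ) (m : ℝ) (v : ℝ → (Fin 2 → ℝ) → ℝ) (τ : ℝ) : ℝ :=
  ∑ I ∈ multiIndices s, (1/2) * ∫ z : Fin 2 → ℝ,
    ((deriv (fun σ => GammaI I (v σ) z) τ) ^ 2
      + (1 / τ ^ 2) * ∑ j, ∑ k,
          gmat z j k * pd j (GammaI I (v τ)) z * pd k (GammaI I (v τ)) z
      + m ^ 2 * (GammaI I (v τ) z) ^ 2) * Real.sqrt (Gfun z)
noncomputable section

/-- Iterated partial derivatives `∂_z^L` for a multi-index `L ∈ ℕ²`. -/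
def pdIter (L : ℕ × ℕ) (f : (Fin 2 → ℝ) → ℝ) : (Fin 2 → ℝ) → ℝ :=
  (pd 0)^[L.1] ((pd 1)^[L.2] f)

/-- The symbol class `S⁰`: smooth functions with `⟨z⟩^{|L|} ∂_z^L a` bounded for all `L`. -/
def MemS0 (a : (Fin 2 → ℝ) → ℝ) : Prop :=
  ContDiff ℝ (⊤ : ℕ∞) a ∧ ∀ L : ℕ × ℕ, ∃ C : ℝ, ∀ z, zjap z ^ (L.1 + L.2) * |pdIter L a z| ≤ C

/-- The entire function `s ↦ ∑ sⁿ / (2n+1)!`, which satisfies `r * sinhcSq (r ^ 2) = sinh r`. -/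
def sinhcSq (s : ℝ) : ℝ :=
  FormalMultilinearSeries.ofScalarsSum (E := ℝ) (fun n : ℕ => (((2 * n + 1).factorial : ℝ))⁻¹) s

lemma hasFPowerSeriesOnBall_sinhcSq :
    HasFPowerSeriesOnBall sinhcSq
      (FormalMultilinearSeries.ofScalars ℝ (fun n : ℕ => (((2 * n + 1).factorial : ℝ))⁻¹)) 0 ⊤ := by
  have hrad : (FormalMultilinearSeries.ofScalars ℝ
      (fun n : ℕ => (((2 * n + 1).factorial : ℝ))⁻¹)).radius = ⊤ := by
    apply FormalMultilinearSeries.ofScalars_radius_eq_top_of_tendsto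
    · exact Eventually.of_forall fun n => inv_ne_zero (by positivity)
    · have h : ∀ n : ℕ, ‖(((2 * n.succ + 1).factorial : ℝ))⁻¹‖ / ‖(((2 * n + 1).factorial : ℝ))⁻¹‖
          ≤ 1 / ((n : ℝ) + 1) := by
        intro n
        have e : (2 * n.succ + 1).factorial
            = (2 * n + 3) * ((2 * n + 2) * (2 * n + 1).factorial) := by
          rw [show 2 * n.succ + 1 = (2 * n + 1 + 1) + 1 by simp; ring, Nat.factorial_succ,
            Nat.factorial_succ]
        rw [norm_inv, norm_inv, Real.norm_natCast, Real.norm_natCast, e]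
        have hf : (0 : ℝ) < ((2 * n + 1).factorial : ℝ) := by positivity
        push_cast
        rw [div_le_div_iff₀ (by positivity) (by positivity)]
        field_simp
        nlinarith [(n.cast_nonneg : (0 : ℝ) ≤ n)]
      exact squeeze_zero (fun n => by positivity) h tendsto_one_div_add_atTop_nhds_zero_nat
  have h := FormalMultilinearSeries.hasFPowerSeriesOnBall
    (FormalMultilinearSeries.ofScalars ℝ (fun n : ℕ => (((2 * n + 1).factorial : ℝ))⁻¹))
    (by rw [hrad]; exact ENNReal.zero_lt_top)
  rw [hrad] at h
  exact h

lemma contDiff_sinhcSq : ContDiff ℝ (⊤ : ℕ∞) sinhcSq := by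
  have h : AnalyticOnNhd ℝ sinhcSq univ := fun x _ =>
    hasFPowerSeriesOnBall_sinhcSq.analyticAt_of_mem (by simp)
  exact contDiffOn_univ.1 (h.contDiffOn uniqueDiffOn_univ)

lemma hasSum_sinhcSq (s : ℝ) :
    HasSum (fun n : ℕ => s ^ n / ((2 * n + 1).factorial : ℝ)) (sinhcSq s) := by
  have h := hasFPowerSeriesOnBall_sinhcSq.hasSum (y := s) (by simp)
  simpa [FormalMultilinearSeries.ofScalars_apply_eq, div_eq_mul_inv] using h

lemma mul_sinhcSq_sq (r : ℝ) : r * sinhcSq (r ^ 2) = Real.sinh r := by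
  have h := (hasSum_sinhcSq (r ^ 2)).mul_left r
  refine h.unique ?_
  have e : (fun n : ℕ => r * ((r ^ 2) ^ n / ((2 * n + 1).factorial : ℝ)))
      = fun n : ℕ => r ^ (2 * n + 1) / ((2 * n + 1).factorial : ℝ) := by
    funext n
    ring
  rw [e]
  exact Real.hasSum_sinh r

lemma pow_div_factorial_le_sinhcSq {s : ℝ} (hs : 0 ≤ s) (n : ℕ) :
    s ^ n / ((2 * n + 1).factorial : ℝ) ≤ sinhcSq s :=
  le_hasSum (hasSum_sinhcSq s) n fun _ _ => by positivity

lemma one_le_sinhcSq {s : ℝ} (hs : 0 ≤ s) : 1 ≤ sinhcSq s := by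
  simpa using pow_div_factorial_le_sinhcSq hs 0

lemma sinhcSq_zero : sinhcSq 0 = 1 := by
  have h := hasSum_sinhcSq 0
  refine h.unique ?_
  simpa using hasSum_single (f := fun n : ℕ => (0 : ℝ) ^ n / ((2 * n + 1).factorial : ℝ)) 0
    fun n hn => by simp [hn]

/-- Every power of `1 + s` is dominated by a multiple of `sinhcSq`. -/
lemma one_add_pow_le_sinhcSq (n : ℕ) :
    ∃ C : ℝ, 0 ≤ C ∧ ∀ s : ℝ, 0 ≤ s → (1 + s) ^ n ≤ C * sinhcSq s := by
  refine ⟨2 ^ n * (1 + (2 * n + 1).factorial), by positivity, fun s hs => ?_⟩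
  have h1 := one_le_sinhcSq hs
  have h2 := pow_div_factorial_le_sinhcSq hs n
  rw [div_le_iff₀ (by positivity)] at h2
  have h3 : (1 + s) ^ n ≤ 2 ^ n * (1 + s ^ n) := by
    rcases le_total s 1 with h | h
    · calc (1 + s) ^ n ≤ 2 ^ n := by gcongr; linarith
        _ ≤ 2 ^ n * (1 + s ^ n) := le_mul_of_one_le_right (by positivity) (by simp; positivity)
    · calc (1 + s) ^ n ≤ (2 * s) ^ n := by gcongr; linarith
        _ = 2 ^ n * s ^ n := mul_pow ..
        _ ≤ 2 ^ n * (1 + s ^ n) := by gcongr; linarith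
  calc (1 + s) ^ n ≤ 2 ^ n * (1 + s ^ n) := h3
    _ ≤ 2 ^ n * (sinhcSq s + sinhcSq s * (2 * n + 1).factorial) := by gcongr
    _ = _ := by ring

lemma differentiable_sinhcSq : Differentiable ℝ sinhcSq :=
  contDiff_sinhcSq.differentiable (by simp)

lemma contDiff_deriv_sinhcSq : ContDiff ℝ (⊤ : ℕ∞) (deriv sinhcSq) :=
  (contDiff_infty_iff_deriv.1 contDiff_sinhcSq).2

lemma differentiable_deriv_sinhcSq : Differentiable ℝ (deriv sinhcSq) :=
  contDiff_deriv_sinhcSq.differentiable (by simp)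

lemma sinhcSq_add_deriv (r : ℝ) :
    sinhcSq (r ^ 2) + 2 * r ^ 2 * deriv sinhcSq (r ^ 2) = Real.cosh r := by
  have h1 : HasDerivAt (fun r : ℝ => r * sinhcSq (r ^ 2))
      (1 * sinhcSq (r ^ 2) + r * (deriv sinhcSq (r ^ 2) * (2 * r))) r := by
    have hsq : HasDerivAt (fun r : ℝ => r ^ 2) (2 * r) r := by simpa using hasDerivAt_pow 2 r
    exact (hasDerivAt_id r).mul ((differentiable_sinhcSq (r ^ 2)).hasDerivAt.comp r hsq)
  have h2 : (fun r : ℝ => r * sinhcSq (r ^ 2)) = Real.sinh := funext mul_sinhcSq_sq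
  rw [h2] at h1
  rw [← h1.unique (Real.hasDerivAt_sinh r)]
  ring

lemma sinhcSq_ode {s : ℝ} (hs : 0 ≤ s) :
    4 * s * deriv (deriv sinhcSq) s = sinhcSq s - 6 * deriv sinhcSq s := by
  have key : ∀ r : ℝ, r ≠ 0 → 4 * r ^ 2 * deriv (deriv sinhcSq) (r ^ 2)
      = sinhcSq (r ^ 2) - 6 * deriv sinhcSq (r ^ 2) := by
    intro r hr
    have hsq : HasDerivAt (fun r : ℝ => r ^ 2) (2 * r) r := by simpa using hasDerivAt_pow 2 r
    have h1 := ((differentiable_sinhcSq (r ^ 2)).hasDerivAt.comp r hsq).add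
      ((hsq.const_mul 2).mul ((differentiable_deriv_sinhcSq (r ^ 2)).hasDerivAt.comp r hsq))
    have h2 : (sinhcSq ∘ (fun r : ℝ => r ^ 2)
        + (fun r : ℝ => 2 * r ^ 2) * (deriv sinhcSq ∘ fun r : ℝ => r ^ 2)) = Real.cosh :=
      funext sinhcSq_add_deriv
    rw [h2] at h1
    have h3 := h1.unique (Real.hasDerivAt_cosh r)
    rw [← mul_sinhcSq_sq] at h3
    apply mul_left_cancel₀ hr
    simp only [Function.comp] at h3
    linear_combination h3
  have hcont : Continuous (deriv (deriv sinhcSq)) :=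
    (contDiff_infty_iff_deriv.1 contDiff_deriv_sinhcSq).2.continuous
  have hext : (fun r : ℝ => 4 * r ^ 2 * deriv (deriv sinhcSq) (r ^ 2))
      = fun r => sinhcSq (r ^ 2) - 6 * deriv sinhcSq (r ^ 2) := by
    refine Continuous.ext_on (dense_compl_singleton (0 : ℝ)) ?_ ?_ fun r hr => key r hr
    · fun_prop
    · have := contDiff_sinhcSq.continuous
      have := contDiff_deriv_sinhcSq.continuous
      fun_prop
  have := congrFun hext (Real.sqrt s)
  simpa [Real.sq_sqrt hs] using this

/-- Directional derivatives of a smooth function commute. -/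
lemma fderiv_fderiv_comm {E : Type*} [NormedAddCommGroup E] [NormedSpace ℝ E] {f : E → ℝ}
    (hf : ContDiff ℝ (⊤ : ℕ∞) f) (u w x : E) :
    fderiv ℝ (fun y => fderiv ℝ f y u) x w = fderiv ℝ (fun y => fderiv ℝ f y w) x u := by
  have hd : DifferentiableAt ℝ (fderiv ℝ f) x :=
    ((contDiff_infty_iff_fderiv.1 hf).2.differentiable (by simp)) x
  have h : ∀ a b : E, fderiv ℝ (fun y => fderiv ℝ f y a) x b = fderiv ℝ (fderiv ℝ f) x b a := by
    intro a b
    rw [fderiv_clm_apply hd (differentiableAt_const a)]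
    simp
  rw [h, h]
  exact (hf.contDiffAt.isSymmSndFDerivAt
    (by rw [minSmoothness_of_isRCLikeNormedField]; exact WithTop.coe_le_coe.2 le_top)) w u

lemma contDiff_fderiv_apply {E : Type*} [NormedAddCommGroup E] [NormedSpace ℝ E] {f : E → ℝ}
    (hf : ContDiff ℝ (⊤ : ℕ∞) f) (u : E) : ContDiff ℝ (⊤ : ℕ∞) (fun y => fderiv ℝ f y u) :=
  (contDiff_infty_iff_fderiv.1 hf).2.clm_apply contDiff_const

/-- The algebra of smooth real functions on the plane. -/
def smoothAlg : Subalgebra ℝ ((Fin 2 → ℝ) → ℝ) where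
  carrier := {f | ContDiff ℝ (⊤ : ℕ∞) f}
  mul_mem' {a b} (ha : ContDiff ℝ (⊤ : ℕ∞) a) (hb : ContDiff ℝ (⊤ : ℕ∞) b) := ha.mul hb
  add_mem' {a b} (ha : ContDiff ℝ (⊤ : ℕ∞) a) (hb : ContDiff ℝ (⊤ : ℕ∞) b) := ha.add hb
  algebraMap_mem' c := (contDiff_const : ContDiff ℝ (⊤ : ℕ∞) fun _ : Fin 2 → ℝ => c)

namespace smoothAlg

lemma contDiff (a : smoothAlg) : ContDiff ℝ (⊤ : ℕ∞) a.1 := a.2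

lemma differentiableAt (a : smoothAlg) (z : Fin 2 → ℝ) : DifferentiableAt ℝ a.1 z :=
  (contDiff a).differentiable (by simp) z

/-- A smooth function as an element of `smoothAlg`. -/
abbrev mk (f : (Fin 2 → ℝ) → ℝ) (hf : ContDiff ℝ (⊤ : ℕ∞) f) : smoothAlg := ⟨f, hf⟩

@[ext] lemma ext {a b : smoothAlg} (h : ∀ z, a.1 z = b.1 z) : a = b := Subtype.ext (funext h)

lemma mul_val (a b : smoothAlg) (z) : (a * b).1 z = a.1 z * b.1 z := rfl
lemma one_val (z) : (1 : smoothAlg).1 z = 1 := rfl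
lemma zero_val (z) : (0 : smoothAlg).1 z = 0 := rfl

end smoothAlg

lemma contDiff_pd (k : Fin 2) {f : (Fin 2 → ℝ) → ℝ} (hf : ContDiff ℝ (⊤ : ℕ∞) f) :
    ContDiff ℝ (⊤ : ℕ∞) (pd k f) := contDiff_fderiv_apply hf _

/-- The partial derivative `∂_{z_k}` as a derivation of the algebra of smooth functions. -/
def pdDer (k : Fin 2) : Derivation ℝ smoothAlg smoothAlg where
  toFun a := ⟨pd k a, contDiff_pd k a.2⟩
  map_add' a b := by
    ext z
    change fderiv ℝ (a.1 + b.1) z _ = fderiv ℝ a.1 z _ + fderiv ℝ b.1 z _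
    rw [fderiv_add (smoothAlg.differentiableAt a z) (smoothAlg.differentiableAt b z)]
    rfl
  map_smul' c a := by
    ext z
    change fderiv ℝ (c • a.1) z _ = c * fderiv ℝ a.1 z _
    rw [fderiv_const_smul (smoothAlg.differentiableAt a z)]
    rfl
  map_one_eq_zero' := by
    ext z
    change fderiv ℝ (fun _ => (1 : ℝ)) z _ = 0
    simp
  leibniz' a b := by
    ext z
    change fderiv ℝ (a.1 * b.1) z _ = a.1 z * fderiv ℝ b.1 z _ + b.1 z * fderiv ℝ a.1 z _
    rw [fderiv_mul (smoothAlg.differentiableAt a z) (smoothAlg.differentiableAt b z)]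
    rfl

lemma pdDer_comm (k l : Fin 2) (a : smoothAlg) : pdDer k (pdDer l a) = pdDer l (pdDer k a) := by
  ext z
  exact fderiv_fderiv_comm a.2 _ _ z

/-- The coordinate functions as elements of the algebra of smooth functions. -/
def zc (k : Fin 2) : smoothAlg := smoothAlg.mk (fun z => z k) (contDiff_apply ℝ ℝ k)

lemma pdDer_zc (k l : Fin 2) : pdDer k (zc l) = if k = l then 1 else 0 := by
  ext z
  change fderiv ℝ (fun w : Fin 2 → ℝ => w l) z (Pi.single k 1) = _
  have h : HasFDerivAt (fun w : Fin 2 → ℝ => w l)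
      (ContinuousLinearMap.proj (R := ℝ) (φ := fun _ : Fin 2 => ℝ) l) z :=
    hasFDerivAt_apply l z
  rw [h.fderiv]
  by_cases hkl : k = l
  · subst hkl
    simp [smoothAlg.one_val]
  · simp [hkl, Ne.symm hkl, smoothAlg.zero_val]

/-- `|z|²` as a smooth function. -/
def rsq : smoothAlg := zc 0 ^ 2 + zc 1 ^ 2

lemma rsq_val (z) : rsq.1 z = z 0 ^ 2 + z 1 ^ 2 := rfl

lemma rsq_nonneg (z) : 0 ≤ rsq.1 z := by rw [rsq_val]; positivity

lemma pdDer_rsq (k : Fin 2) : pdDer k rsq = 2 * zc k := by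
  fin_cases k <;> simp [rsq, Derivation.leibniz_pow, pdDer_zc, two_mul, two_smul]

/-- Chain rule for functions of `|z|²`. -/
lemma pd_comp_rsq {F : ℝ → ℝ} (k : Fin 2) (z : Fin 2 → ℝ)
    (hF : DifferentiableAt ℝ F (rsq.1 z)) :
    pd k (fun w => F (rsq.1 w)) z = 2 * z k * deriv F (rsq.1 z) := by
  have h := hF.hasDerivAt.comp_hasFDerivAt z (smoothAlg.differentiableAt rsq z).hasFDerivAt
  have h2 : fderiv ℝ rsq.1 z (Pi.single k 1) = 2 * z k := by
    have := congrArg (fun a : smoothAlg => a.1 z) (pdDer_rsq k)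
    exact this
  unfold pd
  have h3 : (fun w => F (rsq.1 w)) = F ∘ rsq.1 := rfl
  rw [h3, h.fderiv]
  simp [h2]
  ring

lemma sinhcSq_rsq_pos (z) : 0 < sinhcSq (rsq.1 z) :=
  lt_of_lt_of_le one_pos (one_le_sinhcSq (rsq_nonneg z))

/-- `sinh |z| / |z|` as a smooth function. -/
def sinhcFun : smoothAlg :=
  smoothAlg.mk (fun z => sinhcSq (rsq.1 z)) (contDiff_sinhcSq.comp (smoothAlg.contDiff rsq))

/-- The inverse of `sinhcFun`. -/
def sinhcInv : smoothAlg :=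
  smoothAlg.mk (fun z => (sinhcSq (rsq.1 z))⁻¹)
    ((smoothAlg.contDiff sinhcFun).inv fun z => (sinhcSq_rsq_pos z).ne')

/-- `(|z| coth |z| - 1) / |z|²` as a smooth function. -/
def cothRem : smoothAlg :=
  smoothAlg.mk (fun z => 2 * deriv sinhcSq (rsq.1 z) / sinhcSq (rsq.1 z))
    ((contDiff_const.mul (contDiff_deriv_sinhcSq.comp (smoothAlg.contDiff rsq))).div
      (smoothAlg.contDiff sinhcFun) fun z => (sinhcSq_rsq_pos z).ne')

/-- The smooth function for which `∂_{z_k} cothRem = z_k * cothRemDeriv`. -/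
def cothRemDeriv : smoothAlg :=
  smoothAlg.mk
    (fun z => 4 * (deriv (deriv sinhcSq) (rsq.1 z) * sinhcSq (rsq.1 z)
      - deriv sinhcSq (rsq.1 z) ^ 2) / sinhcSq (rsq.1 z) ^ 2)
    ((contDiff_const.mul
      ((((contDiff_infty_iff_deriv.1 contDiff_deriv_sinhcSq).2.comp
        (smoothAlg.contDiff rsq)).mul (smoothAlg.contDiff sinhcFun)).sub
      ((contDiff_deriv_sinhcSq.comp (smoothAlg.contDiff rsq)).pow 2))).div
      ((smoothAlg.contDiff sinhcFun).pow 2) fun z => (pow_pos (sinhcSq_rsq_pos z) 2).ne')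

lemma sinhcFun_mul_inv : sinhcFun * sinhcInv = 1 := by
  ext z
  exact mul_inv_cancel₀ (sinhcSq_rsq_pos z).ne'

lemma pdDer_sinhcFun (k : Fin 2) : pdDer k sinhcFun = zc k * cothRem * sinhcFun := by
  ext z
  change pd k (fun w => sinhcSq (rsq.1 w)) z = z k * (2 * _ / _) * sinhcSq (rsq.1 z)
  rw [pd_comp_rsq k z (differentiable_sinhcSq _)]
  have := (sinhcSq_rsq_pos z).ne'
  field_simp

lemma pdDer_cothRem (k : Fin 2) : pdDer k cothRem = zc k * cothRemDeriv := by
  ext z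
  have h0 := (sinhcSq_rsq_pos z).ne'
  have hd : HasDerivAt (fun s => 2 * deriv sinhcSq s / sinhcSq s) _ (rsq.1 z) :=
    ((differentiable_deriv_sinhcSq (rsq.1 z)).hasDerivAt.const_mul 2).div
      (differentiable_sinhcSq (rsq.1 z)).hasDerivAt h0
  change pd k (fun w => (fun s => 2 * deriv sinhcSq s / sinhcSq s) (rsq.1 w)) z
    = z k * (4 * _ / _)
  rw [pd_comp_rsq k z hd.differentiableAt, hd.deriv]
  field_simp
  ring

lemma rsq_mul_cothRemDeriv :
    (zc 0 ^ 2 + zc 1 ^ 2) * cothRemDeriv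
      = 1 - 3 * cothRem - (zc 0 ^ 2 + zc 1 ^ 2) * cothRem ^ 2 := by
  change rsq * cothRemDeriv = 1 - 3 * cothRem - rsq * cothRem ^ 2
  ext z
  have h0 := (sinhcSq_rsq_pos z).ne'
  have hode := sinhcSq_ode (rsq_nonneg z)
  change rsq.1 z * (4 * (_ * _ - _) / _)
    = 1 - 3 * (2 * _ / _) - rsq.1 z * (2 * _ / _) ^ 2
  field_simp
  linear_combination sinhcSq (rsq.1 z) * hode

/-- `|z| coth |z|` as a smooth function. -/
def cothFun : smoothAlg := 1 + (zc 0 ^ 2 + zc 1 ^ 2) * cothRem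

lemma znorm_sq (z) : znorm z ^ 2 = rsq.1 z := Real.sq_sqrt (rsq_nonneg z)

lemma znorm_mul_sinhcSq (z) : znorm z * sinhcSq (rsq.1 z) = Real.sinh (znorm z) := by
  rw [← znorm_sq, mul_sinhcSq_sq]

lemma cothFun_val_mul (z) : cothFun.1 z * sinhcSq (rsq.1 z) = Real.cosh (znorm z) := by
  rw [← sinhcSq_add_deriv, znorm_sq]
  have h0 := (sinhcSq_rsq_pos z).ne'
  change (1 + rsq.1 z * (2 * _ / _)) * _ = _
  field_simp

lemma cothFun_sq : cothFun ^ 2 = rsq + sinhcInv ^ 2 := by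
  ext z
  have h0 := (sinhcSq_rsq_pos z).ne'
  have h1 := cothFun_val_mul z
  have h2 := znorm_mul_sinhcSq z
  have h3 := Real.cosh_sq (znorm z)
  rw [← h1, ← h2] at h3
  change cothFun.1 z ^ 2 = rsq.1 z + (sinhcSq (rsq.1 z))⁻¹ ^ 2
  rw [mul_pow, mul_pow, znorm_sq] at h3
  field_simp
  linear_combination h3

/-- The coefficients `c_{jk}` as smooth functions. -/
def cothMat (j k : Fin 2) : smoothAlg := (if j = k then cothFun else 0) - cothRem * zc j * zc k

/-- The vector fields `Γ₁, Γ₂, Γ₃` as derivations of the algebra of smooth functions. -/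
def gammaDer : Fin 3 → Derivation ℝ smoothAlg smoothAlg
  | 0 => cothMat 0 0 • pdDer 0 + cothMat 0 1 • pdDer 1
  | 1 => cothMat 1 0 • pdDer 0 + cothMat 1 1 • pdDer 1
  | 2 => zc 0 • pdDer 1 - zc 1 • pdDer 0

lemma gammaDer_zero_apply (a : smoothAlg) : gammaDer 0 a
    = (1 + cothRem * zc 1 ^ 2) * pdDer 0 a - cothRem * zc 0 * zc 1 * pdDer 1 a := by
  simp only [gammaDer, cothMat, cothFun, Derivation.add_apply, Derivation.smul_apply, smul_eq_mul]
  simp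
  ring

lemma gammaDer_one_apply (a : smoothAlg) : gammaDer 1 a
    = (1 + cothRem * zc 0 ^ 2) * pdDer 1 a - cothRem * zc 0 * zc 1 * pdDer 0 a := by
  simp only [gammaDer, cothMat, cothFun, Derivation.add_apply, Derivation.smul_apply, smul_eq_mul]
  simp
  ring

lemma gammaDer_two_apply (a : smoothAlg) :
    gammaDer 2 a = zc 0 * pdDer 1 a - zc 1 * pdDer 0 a := rfl

lemma gammaDer_comm_zero_one (a : smoothAlg) :
    gammaDer 0 (gammaDer 1 a) = gammaDer 1 (gammaDer 0 a) + gammaDer 2 a := by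
  simp only [gammaDer_zero_apply, gammaDer_one_apply, gammaDer_two_apply, map_add, map_sub,
    Derivation.leibniz, Derivation.leibniz_pow, Derivation.map_one_eq_zero, smul_eq_mul,
    pdDer_cothRem, pdDer_zc, pdDer_comm 1 0 a]
  simp
  linear_combination (zc 0 * pdDer 1 a - zc 1 * pdDer 0 a) * rsq_mul_cothRemDeriv

lemma gammaDer_comm_two_zero (a : smoothAlg) :
    gammaDer 2 (gammaDer 0 a) = gammaDer 0 (gammaDer 2 a) - gammaDer 1 a := by
  simp only [gammaDer_zero_apply, gammaDer_one_apply, gammaDer_two_apply, map_add, map_sub,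
    Derivation.leibniz, Derivation.leibniz_pow, Derivation.map_one_eq_zero, smul_eq_mul,
    pdDer_cothRem, pdDer_zc, pdDer_comm 1 0 a]
  simp
  ring

lemma gammaDer_comm_two_one (a : smoothAlg) :
    gammaDer 2 (gammaDer 1 a) = gammaDer 1 (gammaDer 2 a) + gammaDer 0 a := by
  simp only [gammaDer_zero_apply, gammaDer_one_apply, gammaDer_two_apply, map_add, map_sub,
    Derivation.leibniz, Derivation.leibniz_pow, Derivation.map_one_eq_zero, smul_eq_mul,
    pdDer_cothRem, pdDer_zc, pdDer_comm 1 0 a]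
  simp
  ring

/-- The coefficients `g^{jk}` as smooth functions. -/
def metricMat (j k : Fin 2) : smoothAlg :=
  (if j = k then 1 - (1 - cothRem - cothRem * cothFun) * rsq else 0)
    + (1 - cothRem - cothRem * cothFun) * zc j * zc k

lemma sinhcInv_mul_divergence (a b : smoothAlg) :
    sinhcInv * (pdDer 0 (sinhcFun * a) + pdDer 1 (sinhcFun * b))
      = pdDer 0 a + pdDer 1 b + cothRem * (zc 0 * a + zc 1 * b) := by
  simp only [Derivation.leibniz, smul_eq_mul, pdDer_sinhcFun]
  linear_combination (pdDer 0 a + pdDer 1 b + cothRem * (zc 0 * a + zc 1 * b)) * sinhcFun_mul_inv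

/-- The Casimir element `Γ₁² + Γ₂² - Γ₃²`, expressed in divergence form. -/
lemma casimir_eq_divergence (a : smoothAlg) :
    gammaDer 0 (gammaDer 0 a) + gammaDer 1 (gammaDer 1 a) - gammaDer 2 (gammaDer 2 a)
      = sinhcInv * (pdDer 0 (sinhcFun * (metricMat 0 0 * pdDer 0 a + metricMat 0 1 * pdDer 1 a))
        + pdDer 1 (sinhcFun * (metricMat 1 0 * pdDer 0 a + metricMat 1 1 * pdDer 1 a))) := by
  rw [sinhcInv_mul_divergence]
  simp only [gammaDer_zero_apply, gammaDer_one_apply, gammaDer_two_apply, map_add, map_sub,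
    metricMat, cothFun, rsq, if_true, Fin.isValue, zero_ne_one, one_ne_zero, if_false,
    Derivation.leibniz, Derivation.leibniz_pow, Derivation.map_one_eq_zero, smul_eq_mul,
    pdDer_cothRem, pdDer_zc, pdDer_comm 1 0 a]
  simp
  ring

lemma sqrt_Gfun (z) : Real.sqrt (Gfun z) = sinhcFun.1 z := by
  have h : sinhc (znorm z) = sinhcSq (rsq.1 z) := by
    unfold sinhc
    split_ifs with h0
    · rw [← znorm_sq, h0]
      simp [sinhcSq_zero]
    · rw [← znorm_mul_sinhcSq]
      field_simp
  rw [Gfun, h, Real.sqrt_sq (sinhcSq_rsq_pos z).le]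
  rfl

lemma eq_zero_of_znorm_eq_zero {z : Fin 2 → ℝ} (h : znorm z = 0) : z 0 = 0 ∧ z 1 = 0 := by
  have h1 := znorm_sq z
  rw [h, rsq_val] at h1
  constructor <;> nlinarith [sq_nonneg (z 0), sq_nonneg (z 1)]

lemma cothFun_val (z) : cothFun.1 z = 1 + rsq.1 z * cothRem.1 z := rfl

lemma cmat_eq (z) (j k : Fin 2) : cmat z j k = (cothMat j k).1 z := by
  have hval : (cothMat j k).1 z
      = (if j = k then cothFun.1 z else 0) - cothRem.1 z * z j * z k := by
    unfold cothMat
    split_ifs <;> rfl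
  rw [hval]
  unfold cmat
  split_ifs with h0 hjk hjk
  · obtain ⟨h1, h2⟩ := eq_zero_of_znorm_eq_zero h0
    have h3 : z j = 0 := by fin_cases j <;> assumption
    rw [cothFun_val, ← znorm_sq, h0, h3]
    simp
  · obtain ⟨h1, h2⟩ := eq_zero_of_znorm_eq_zero h0
    have h3 : z j = 0 := by fin_cases j <;> assumption
    simp [h3]
  all_goals
    have hs := (sinhcSq_rsq_pos z).ne'
    have hc : znorm z / Real.tanh (znorm z) = 1 + znorm z ^ 2 * cothRem.1 z := by
      rw [Real.tanh_eq_sinh_div_cosh, ← znorm_mul_sinhcSq, ← cothFun_val_mul, znorm_sq,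
        ← cothFun_val]
      field_simp
    simp only [hc, cothFun_val, ← znorm_sq]
    field_simp
    ring

lemma gmat_eq (z) (j k : Fin 2) : gmat z j k = (metricMat j k).1 z := by
  have hval : (metricMat j k).1 z
      = (if j = k then 1 - (1 - cothRem.1 z - cothRem.1 z * cothFun.1 z) * rsq.1 z else 0)
        + (1 - cothRem.1 z - cothRem.1 z * cothFun.1 z) * z j * z k := by
    unfold metricMat
    split_ifs <;> rfl
  rw [hval]
  unfold gmat
  split_ifs with h0 hjk hjk
  · obtain ⟨h1, h2⟩ := eq_zero_of_znorm_eq_zero h0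
    have h3 : z j = 0 := by fin_cases j <;> assumption
    rw [← znorm_sq, h0, h3]
    simp
  · obtain ⟨h1, h2⟩ := eq_zero_of_znorm_eq_zero h0
    have h3 : z j = 0 := by fin_cases j <;> assumption
    simp [h3]
  all_goals
    have hs := (sinhcSq_rsq_pos z).ne'
    have hd : 1 / znorm z ^ 2 - 1 / Real.sinh (znorm z) ^ 2
        = 1 - cothRem.1 z - cothRem.1 z * cothFun.1 z := by
      have hsq : cothFun.1 z ^ 2 = rsq.1 z + (sinhcSq (rsq.1 z))⁻¹ ^ 2 :=
        congrArg (fun a : smoothAlg => a.1 z) cothFun_sq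
      have h1 := cothFun_val z
      rw [← znorm_mul_sinhcSq]
      rw [← znorm_sq] at *
      have h2 : 1 / (znorm z * sinhcSq (znorm z ^ 2)) ^ 2
          = (sinhcSq (znorm z ^ 2))⁻¹ ^ 2 / znorm z ^ 2 := by
        field_simp
      rw [h2, div_sub_div_same, div_eq_iff (pow_ne_zero 2 h0)]
      linear_combination hsq - (1 + cothFun.1 z) * h1
    rw [hd]
    unfold Mmat
    fin_cases j <;> fin_cases k <;> simp [rsq_val] at hjk ⊢ <;> ring

lemma GammaOp_coe (j : Fin 3) (a : smoothAlg) : GammaOp j a.1 = (gammaDer j a).1 := by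
  funext z
  fin_cases j
  · simp [GammaOp, cmat_eq]
    rfl
  · simp [GammaOp, cmat_eq]
    rfl
  · rfl

/-- The Casimir operator `Γ₁² + Γ₂² - Γ₃²`. -/
def casimir : Module.End ℝ smoothAlg :=
  (gammaDer 0 : Module.End ℝ smoothAlg) * gammaDer 0
    + (gammaDer 1 : Module.End ℝ smoothAlg) * gammaDer 1
    - (gammaDer 2 : Module.End ℝ smoothAlg) * gammaDer 2

lemma casimir_apply (a : smoothAlg) : casimir a
    = gammaDer 0 (gammaDer 0 a) + gammaDer 1 (gammaDer 1 a) - gammaDer 2 (gammaDer 2 a) := rfl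

lemma Lam0_coe (a : smoothAlg) : Lam0 a.1 = (casimir a).1 := by
  funext z
  rw [casimir_apply, casimir_eq_divergence]
  simp only [Lam0, sqrt_Gfun, gmat_eq, Fin.sum_univ_two]
  rfl

/-- The Japanese bracket as a smooth function. -/
def japFun : smoothAlg :=
  smoothAlg.mk zjap ((contDiff_const.add (smoothAlg.contDiff rsq)).sqrt
    fun z => by have := rsq_nonneg z; positivity)

lemma one_le_zjap (z) : 1 ≤ zjap z := by
  rw [zjap, Real.one_le_sqrt]
  nlinarith [sq_nonneg (z 0), sq_nonneg (z 1)]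

lemma zjap_pos (z) : 0 < zjap z := one_pos.trans_le (one_le_zjap z)

lemma zjap_sq (z) : zjap z ^ 2 = 1 + rsq.1 z :=
  Real.sq_sqrt (by have := rsq_nonneg z; rw [rsq_val] at this; positivity)

/-- The inverse of the Japanese bracket as a smooth function. -/
def japInv : smoothAlg :=
  smoothAlg.mk (fun z => (zjap z)⁻¹) ((smoothAlg.contDiff japFun).inv fun z => (zjap_pos z).ne')

lemma japFun_mul_japInv : japFun * japInv = 1 := by
  ext z
  exact mul_inv_cancel₀ (zjap_pos z).ne'

lemma japFun_sq : japFun ^ 2 = 1 + rsq := by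
  ext z
  exact zjap_sq z

lemma pdDer_japFun (k : Fin 2) : pdDer k japFun = zc k * japInv := by
  have h := congrArg (pdDer k) japFun_sq
  simp only [Derivation.leibniz_pow, map_add, Derivation.map_one_eq_zero, pdDer_rsq,
    smul_eq_mul, nsmul_eq_mul] at h
  have h2 : (2 : smoothAlg) * (japFun * pdDer k japFun) = 2 * zc k := by
    simpa [mul_assoc] using h
  have h3 : japFun * pdDer k japFun = zc k := by
    ext z
    have := congrArg (fun a : smoothAlg => a.1 z) h2
    exact mul_left_cancel₀ (two_ne_zero (α := ℝ)) this
  linear_combination japInv * h3 - pdDer k japFun * japFun_mul_japInv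

lemma pdDer_japInv (k : Fin 2) : pdDer k japInv = -(zc k * japInv ^ 3) := by
  have h := congrArg (pdDer k) japFun_mul_japInv
  simp only [Derivation.leibniz, Derivation.map_one_eq_zero, pdDer_japFun, smul_eq_mul] at h
  linear_combination japInv * h - pdDer k japInv * japFun_mul_japInv

/-- The functions `Γ_j ⟨z⟩`. -/
def gammaJap : Fin 3 → smoothAlg
  | 0 => zc 0 * japInv
  | 1 => zc 1 * japInv
  | 2 => 0

lemma gammaDer_japFun (j : Fin 3) : gammaDer j japFun = gammaJap j := by
  fin_cases j
  · simp [gammaDer_zero_apply, gammaJap, pdDer_japFun]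
    ring
  · simp [gammaDer_one_apply, gammaJap, pdDer_japFun]
    ring
  · simp [gammaDer_two_apply, gammaJap, pdDer_japFun]
    ring

/-- The weight `e^{c⟨z⟩}` as a smooth function. -/
def expJap (c : ℝ) : smoothAlg :=
  smoothAlg.mk (fun z => Real.exp (c * zjap z))
    ((contDiff_const.mul (smoothAlg.contDiff japFun)).exp)

lemma expJap_mul_expJap_neg (c : ℝ) : expJap c * expJap (-c) = 1 := by
  ext z
  change Real.exp _ * Real.exp _ = 1
  rw [← Real.exp_add]
  simp

lemma pdDer_expJap (k : Fin 2) (c : ℝ) : pdDer k (expJap c) = c • (expJap c * pdDer k japFun) := by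
  ext z
  change fderiv ℝ (fun w => Real.exp (c * zjap w)) z _ = c * (_ * fderiv ℝ zjap z _)
  have h := ((smoothAlg.differentiableAt japFun z).hasFDerivAt.const_mul c).exp
  rw [show (fun w => Real.exp (c * zjap w)) = fun w => Real.exp (c * japFun.1 w) from rfl, h.fderiv]
  change Real.exp (c * zjap z) * (c * fderiv ℝ zjap z _) = c * (Real.exp (c * zjap z) * _)
  ring

lemma gammaDer_expJap (j : Fin 3) (c : ℝ) :
    gammaDer j (expJap c) = c • (expJap c * gammaJap j) := by
  rw [← gammaDer_japFun]
  fin_cases j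
  · simp [gammaDer_zero_apply, pdDer_expJap, Algebra.smul_def]
    ring
  · simp [gammaDer_one_apply, pdDer_expJap, Algebra.smul_def]
    ring
  · simp [gammaDer_two_apply, pdDer_expJap, Algebra.smul_def]
    ring

/-- The zeroth-order coefficient of the conjugated operator. -/
def conjPotential (κ : ℝ) : smoothAlg :=
  κ ^ 2 • (gammaJap 0 ^ 2 + gammaJap 1 ^ 2)
    - κ • (gammaDer 0 (gammaJap 0) + gammaDer 1 (gammaJap 1))

/-- The first-order operator `Λ - Λ₀`. -/
def conjFirstOrder (κ : ℝ) : Module.End ℝ smoothAlg :=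
  ((-2 * κ) • gammaJap 0) • (gammaDer 0 : Module.End ℝ smoothAlg)
    + ((-2 * κ) • gammaJap 1) • (gammaDer 1 : Module.End ℝ smoothAlg)
    + conjPotential κ • (1 : Module.End ℝ smoothAlg)

lemma Lam_coe (κ : ℝ) (a : smoothAlg) : Lam κ a.1 = ((casimir + conjFirstOrder κ) a).1 := by
  have h1 : Lam κ a.1 = (expJap κ * casimir (expJap (-κ) * a)).1 := by
    funext z
    have h : (fun w => Real.exp (-(κ * zjap w)) * a.1 w) = (expJap (-κ) * a).1 := by
      funext w
      change _ = Real.exp (-κ * zjap w) * a.1 w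
      rw [neg_mul]
    rw [Lam, h, Lam0_coe]
    rfl
  rw [h1]
  congr 1
  have h2 := expJap_mul_expJap_neg κ
  simp only [LinearMap.add_apply, casimir_apply, conjFirstOrder, conjPotential,
    LinearMap.smul_apply, Module.End.one_apply, Derivation.coeFn_coe, Derivation.leibniz,
    smul_eq_mul, gammaDer_expJap, map_add, Algebra.smul_def, map_mul, map_neg,
    map_pow, Derivation.map_algebraMap, map_ofNat]
  have h3 : gammaJap 2 = 0 := rfl
  rw [h3]
  simp only [map_zero]
  generalize expJap (-κ) = e at *
  generalize expJap κ = e' at *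
  generalize algebraMap ℝ smoothAlg κ = c at *
  linear_combination (gammaDer 0 (gammaDer 0 a) + gammaDer 1 (gammaDer 1 a)
    - gammaDer 2 (gammaDer 2 a)
    - 2 * c * (gammaJap 0 * gammaDer 0 a + gammaJap 1 * gammaDer 1 a)
    + (c ^ 2 * (gammaJap 0 ^ 2 + gammaJap 1 ^ 2)
      - c * (gammaDer 0 (gammaJap 0) + gammaDer 1 (gammaJap 1))) * a) * h2

/-- `a` satisfies the symbol bounds of order `m` for derivatives up to order `n`. -/
def SymbolLE : ℕ → ℤ → smoothAlg → Prop
  | 0, m, a => ∃ C : ℝ, ∀ z, |a.1 z| ≤ C * zjap z ^ m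
  | n + 1, m, a => (∃ C : ℝ, ∀ z, |a.1 z| ≤ C * zjap z ^ m) ∧ ∀ k, SymbolLE n (m - 1) (pdDer k a)

/-- The symbol class of order `m`. -/
def IsSymbol (m : ℤ) (a : smoothAlg) : Prop := ∀ n, SymbolLE n m a

namespace SymbolLE

variable {n : ℕ} {m m' : ℤ} {a b : smoothAlg}

lemma bound (h : SymbolLE n m a) : ∃ C : ℝ, ∀ z, |a.1 z| ≤ C * zjap z ^ m := by
  cases n with
  | zero => exact h
  | succ n => exact h.1

lemma of_succ (h : SymbolLE (n + 1) m a) : SymbolLE n m a := by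
  induction n generalizing m a with
  | zero => exact h.bound
  | succ n ih => exact ⟨h.1, fun k => ih (h.2 k)⟩

lemma mono (hm : m ≤ m') (h : SymbolLE n m a) : SymbolLE n m' a := by
  have hb : ∀ {m m' : ℤ} {a : smoothAlg}, m ≤ m' → (∃ C : ℝ, ∀ z, |a.1 z| ≤ C * zjap z ^ m) →
      ∃ C : ℝ, ∀ z, |a.1 z| ≤ C * zjap z ^ m' := by
    rintro m m' a hm ⟨C, hC⟩
    refine ⟨|C|, fun z => (hC z).trans ?_⟩
    have := zpow_pos (zjap_pos z) m
    calc C * zjap z ^ m ≤ |C| * zjap z ^ m := by gcongr; exact le_abs_self C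
      _ ≤ |C| * zjap z ^ m' := by
        gcongr
        exact one_le_zjap z
  induction n generalizing m m' a with
  | zero => exact hb hm h
  | succ n ih => exact ⟨hb hm h.1, fun k => ih (by lia) (h.2 k)⟩

lemma add (ha : SymbolLE n m a) (hb : SymbolLE n m b) : SymbolLE n m (a + b) := by
  have hadd : ∀ {m : ℤ} {a b : smoothAlg}, (∃ C : ℝ, ∀ z, |a.1 z| ≤ C * zjap z ^ m) →
      (∃ C : ℝ, ∀ z, |b.1 z| ≤ C * zjap z ^ m) →
      ∃ C : ℝ, ∀ z, |(a + b).1 z| ≤ C * zjap z ^ m := by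
    rintro m a b ⟨C, hC⟩ ⟨D, hD⟩
    refine ⟨C + D, fun z => (abs_add_le _ _).trans ?_⟩
    rw [add_mul]
    exact add_le_add (hC z) (hD z)
  induction n generalizing m a b with
  | zero => exact hadd ha hb
  | succ n ih =>
    refine ⟨hadd ha.1 hb.1, fun k => ?_⟩
    rw [map_add]
    exact ih (ha.2 k) (hb.2 k)

lemma mul (ha : SymbolLE n m a) (hb : SymbolLE n m' b) : SymbolLE n (m + m') (a * b) := by
  have hmul : ∀ {m m' : ℤ} {a b : smoothAlg}, (∃ C : ℝ, ∀ z, |a.1 z| ≤ C * zjap z ^ m) →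
      (∃ C : ℝ, ∀ z, |b.1 z| ≤ C * zjap z ^ m') →
      ∃ C : ℝ, ∀ z, |(a * b).1 z| ≤ C * zjap z ^ (m + m') := by
    rintro m m' a b ⟨C, hC⟩ ⟨D, hD⟩
    refine ⟨C * D, fun z => ?_⟩
    rw [smoothAlg.mul_val, abs_mul, zpow_add₀ (zjap_pos z).ne', mul_mul_mul_comm]
    exact mul_le_mul (hC z) (hD z) (abs_nonneg _) ((abs_nonneg _).trans (hC z))
  induction n generalizing m m' a b with
  | zero => exact hmul ha hb
  | succ n ih =>
    refine ⟨hmul ha.1 hb.1, fun k => ?_⟩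
    rw [Derivation.leibniz, smul_eq_mul, smul_eq_mul]
    refine add ?_ ?_
    · have := ih ha.of_succ (hb.2 k)
      exact this.mono (by lia)
    · have := ih hb.of_succ (ha.2 k)
      exact this.mono (by lia)

lemma zero (n : ℕ) (m : ℤ) : SymbolLE n m 0 := by
  have h : ∀ m : ℤ, ∃ C : ℝ, ∀ z, |(0 : smoothAlg).1 z| ≤ C * zjap z ^ m :=
    fun m => ⟨0, fun z => by simp [smoothAlg.zero_val]⟩
  induction n generalizing m with
  | zero => exact h m
  | succ n ih => exact ⟨h m, fun k => by rw [map_zero]; exact ih _⟩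

end SymbolLE

namespace IsSymbol

variable {m m' : ℤ} {a b : smoothAlg}

lemma of_bound_of_pdDer (h0 : ∃ C : ℝ, ∀ z, |a.1 z| ≤ C * zjap z ^ m)
    (h1 : ∀ k, IsSymbol (m - 1) (pdDer k a)) : IsSymbol m a := by
  intro n
  cases n with
  | zero => exact h0
  | succ n => exact ⟨h0, fun k => h1 k n⟩

lemma pdDer (h : IsSymbol m a) (k : Fin 2) : IsSymbol (m - 1) (pdDer k a) :=
  fun n => (h (n + 1)).2 k

lemma mono (hm : m ≤ m') (h : IsSymbol m a) : IsSymbol m' a := fun n => (h n).mono hm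

lemma add (ha : IsSymbol m a) (hb : IsSymbol m b) : IsSymbol m (a + b) :=
  fun n => (ha n).add (hb n)

lemma mul (ha : IsSymbol m a) (hb : IsSymbol m' b) : IsSymbol (m + m') (a * b) :=
  fun n => (ha n).mul (hb n)

lemma zero (m : ℤ) : IsSymbol m 0 := fun n => SymbolLE.zero n m

lemma algebraMap (c : ℝ) : IsSymbol 0 (algebraMap ℝ smoothAlg c) := by
  refine of_bound_of_pdDer ⟨|c|, fun z => by simp⟩ fun k => ?_
  rw [Derivation.map_algebraMap]
  exact zero _

lemma one : IsSymbol 0 1 := by simpa using algebraMap 1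

lemma smul (c : ℝ) (ha : IsSymbol m a) : IsSymbol m (c • a) := by
  rw [Algebra.smul_def]
  simpa using (algebraMap c).mul ha

lemma neg (ha : IsSymbol m a) : IsSymbol m (-a) := by
  simpa using ha.smul (-1)

lemma sub (ha : IsSymbol m a) (hb : IsSymbol m b) : IsSymbol m (a - b) := by
  rw [sub_eq_add_neg]
  exact ha.add hb.neg

lemma memS0 (h : IsSymbol 0 a) : MemS0 a.1 := by
  refine ⟨a.2, fun L => ?_⟩
  have key : ∀ (k : Fin 2) (n : ℕ) (m : ℤ) (b : smoothAlg), IsSymbol m b →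
      ∃ c : smoothAlg, IsSymbol (m - n) c ∧ (pd k)^[n] b.1 = c.1 := by
    intro k n
    induction n with
    | zero => exact fun m b hb => ⟨b, by simpa using hb, rfl⟩
    | succ n ih =>
      intro m b hb
      obtain ⟨c, hc, e⟩ := ih (m - 1) (_root_.pdDer k b) (hb.pdDer k)
      exact ⟨c, hc.mono (by push_cast; lia), by rw [Function.iterate_succ_apply, ← e]; rfl⟩
  obtain ⟨b, hb, eb⟩ := key 1 L.2 0 a h
  obtain ⟨c, hc, ec⟩ := key 0 L.1 _ b hb
  obtain ⟨C, hC⟩ := (hc 0).bound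
  refine ⟨C, fun z => ?_⟩
  rw [pdIter, eb, ec]
  have hz := zjap_pos z
  calc zjap z ^ (L.1 + L.2) * |c.1 z|
      ≤ zjap z ^ (L.1 + L.2) * (C * zjap z ^ (0 - (L.2 : ℤ) - (L.1 : ℤ))) := by
        gcongr
        exact hC z
    _ = C * (zjap z ^ ((L.1 + L.2 : ℕ) : ℤ) * zjap z ^ (0 - (L.2 : ℤ) - (L.1 : ℤ))) := by
        rw [zpow_natCast]
        ring
    _ = C := by
        rw [← zpow_add₀ hz.ne', show ((L.1 + L.2 : ℕ) : ℤ) + (0 - (L.2 : ℤ) - (L.1 : ℤ)) = 0 by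
          push_cast; ring, zpow_zero, mul_one]

end IsSymbol

lemma abs_coord_le_zjap (k : Fin 2) (z) : |z k| ≤ zjap z := by
  refine Real.abs_le_sqrt ?_
  fin_cases k <;> simp <;> nlinarith [sq_nonneg (z 0), sq_nonneg (z 1)]

lemma isSymbol_zc (k : Fin 2) : IsSymbol 1 (zc k) := by
  refine IsSymbol.of_bound_of_pdDer ⟨1, fun z => ?_⟩ fun l => ?_
  · rw [zpow_one, one_mul]
    exact abs_coord_le_zjap k z
  · rw [pdDer_zc]
    split_ifs
    · exact IsSymbol.one
    · exact IsSymbol.zero _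

lemma isSymbol_japInv : IsSymbol (-1) japInv := by
  have hb : ∃ C : ℝ, ∀ z, |japInv.1 z| ≤ C * zjap z ^ (-1 : ℤ) := by
    refine ⟨1, fun z => ?_⟩
    change |(zjap z)⁻¹| ≤ _
    rw [abs_of_pos (inv_pos.2 (zjap_pos z))]
    simp
  intro n
  induction n with
  | zero => exact hb
  | succ n ih =>
    refine ⟨hb, fun k => ?_⟩
    have h := ((isSymbol_zc k).neg n).mul ((ih.mul ih).mul ih)
    rw [pdDer_japInv, show -(zc k * japInv ^ 3) = -zc k * (japInv * japInv * japInv) by ring]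
    exact h.mono (by norm_num)

/-- Division by `|z|²` in the symbol classes. -/
lemma SymbolLE.of_rsq_mul {n : ℕ} {m : ℤ} {b : smoothAlg} (h : SymbolLE n (m + 2) (rsq * b)) :
    SymbolLE n m b := by
  have hb : ∀ {m : ℤ} {b : smoothAlg}, (∃ C : ℝ, ∀ z, |(rsq * b).1 z| ≤ C * zjap z ^ (m + 2)) →
      ∃ C : ℝ, ∀ z, |b.1 z| ≤ C * zjap z ^ m := by
    rintro m b ⟨C, hC⟩
    obtain ⟨D, hD⟩ := (isCompact_closedBall (0 : Fin 2 → ℝ) 1).exists_bound_of_continuousOn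
      (f := fun z => b.1 z * zjap z ^ (-m)) (by
        refine Continuous.continuousOn ?_
        exact (smoothAlg.contDiff b).continuous.mul
          ((smoothAlg.contDiff japFun).continuous.zpow₀ _ fun z => Or.inl (zjap_pos z).ne'))
    refine ⟨max D (2 * C), fun z => ?_⟩
    have hz := zjap_pos z
    have hzm := zpow_pos hz m
    by_cases hmem : z ∈ Metric.closedBall (0 : Fin 2 → ℝ) 1
    · have h1 := hD z hmem
      rw [norm_mul, Real.norm_eq_abs, Real.norm_eq_abs, abs_of_pos (zpow_pos hz _), zpow_neg,
        ← div_eq_mul_inv, div_le_iff₀ hzm] at h1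
      exact h1.trans (by gcongr; exact le_max_left _ _)
    · have h1 : 1 ≤ rsq.1 z := by
        by_contra hlt
        push Not at hlt
        apply hmem
        rw [mem_closedBall_zero_iff, pi_norm_le_iff_of_nonneg zero_le_one]
        intro k
        rw [rsq_val] at hlt
        rw [Real.norm_eq_abs, abs_le_one_iff_mul_self_le_one]
        fin_cases k <;> simp <;> nlinarith [sq_nonneg (z 0), sq_nonneg (z 1)]
      have h2 := hC z
      rw [smoothAlg.mul_val, abs_mul, abs_of_nonneg (rsq_nonneg z), zpow_add₀ hz.ne'] at h2
      have h3 : zjap z ^ (2 : ℤ) = 1 + rsq.1 z := zjap_sq z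
      rw [h3] at h2
      have hC0 : 0 ≤ C := by
        have h4 : 0 ≤ C * (zjap z ^ m * (1 + rsq.1 z)) := le_trans (by positivity) h2
        exact nonneg_of_mul_nonneg_left h4 (by positivity)
      have h4 : rsq.1 z * |b.1 z| ≤ rsq.1 z * (2 * C * zjap z ^ m) := by
        refine h2.trans ?_
        have : 0 ≤ C * zjap z ^ m := by positivity
        nlinarith
      exact (le_of_mul_le_mul_left h4 (by linarith)).trans (by gcongr; exact le_max_right _ _)
  induction n generalizing m b with
  | zero => exact hb h
  | succ n ih =>
    refine ⟨hb h.1, fun k => ih ?_⟩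
    have hbn : SymbolLE n m b := ih h.of_succ
    have e : rsq * pdDer k b = pdDer k (rsq * b) + (-2 : ℝ) • (zc k * b) := by
      rw [Derivation.leibniz, pdDer_rsq, smul_eq_mul, smul_eq_mul, Algebra.smul_def, map_neg,
        map_ofNat]
      ring
    rw [e]
    refine ((h.2 k).mono (by lia)).add ?_
    rw [Algebra.smul_def]
    exact ((IsSymbol.algebraMap (-2) n).mul ((isSymbol_zc k n).mul hbn)).mono (by lia)

lemma IsSymbol.of_rsq_mul {m : ℤ} {b : smoothAlg} (h : IsSymbol (m + 2) (rsq * b)) :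
    IsSymbol m b := fun n => (h n).of_rsq_mul

lemma pdDer_sinhcInv_sq (k : Fin 2) :
    pdDer k (sinhcInv ^ 2) = (-2 : ℝ) • (zc k * cothRem * sinhcInv ^ 2) := by
  have h := congrArg (pdDer k) sinhcFun_mul_inv
  simp only [Derivation.leibniz, Derivation.map_one_eq_zero, pdDer_sinhcFun, smul_eq_mul] at h
  rw [Derivation.leibniz_pow, Algebra.smul_def (-2 : ℝ), map_neg, map_ofNat]
  simp only [smul_eq_mul, nsmul_eq_mul]
  have h1 : pdDer k sinhcInv = -(zc k * cothRem * sinhcInv) := by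
    linear_combination sinhcInv * h
      - (pdDer k sinhcInv + zc k * cothRem * sinhcInv) * sinhcFun_mul_inv
  rw [h1]
  push_cast
  ring

lemma pdDer_cothFun (k : Fin 2) : pdDer k cothFun = zc k * (1 - cothFun * cothRem) := by
  have h : cothFun = 1 + rsq * cothRem := rfl
  have h2 : rsq * cothRemDeriv = 1 - 3 * cothRem - rsq * cothRem ^ 2 := rsq_mul_cothRemDeriv
  rw [h]
  simp only [map_add, Derivation.leibniz, Derivation.map_one_eq_zero, smul_eq_mul, pdDer_rsq,
    pdDer_cothRem]
  linear_combination zc k * h2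

lemma sinhcInv_sq_bound (m : ℤ) : ∃ C : ℝ, ∀ z, |(sinhcInv ^ 2).1 z| ≤ C * zjap z ^ m := by
  obtain ⟨C, hC0, hC⟩ := one_add_pow_le_sinhcSq m.natAbs
  refine ⟨C, fun z => ?_⟩
  have hz := zjap_pos z
  have h1 := hC _ (rsq_nonneg z)
  have h2 := one_le_sinhcSq (rsq_nonneg z)
  have h0 := sinhcSq_rsq_pos z
  rw [← zjap_sq] at h1
  have h3 : zjap z ^ (-m) ≤ C * sinhcSq (rsq.1 z) := by
    refine le_trans ?_ h1
    rw [← pow_mul, ← zpow_natCast]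
    exact zpow_le_zpow_right₀ (one_le_zjap z) (by rw [Nat.cast_mul]; lia)
  change |(sinhcSq (rsq.1 z))⁻¹ ^ 2| ≤ _
  rw [abs_of_nonneg (by positivity)]
  rw [zpow_neg, inv_le_iff_one_le_mul₀ (zpow_pos hz m)] at h3
  calc (sinhcSq (rsq.1 z))⁻¹ ^ 2 ≤ (sinhcSq (rsq.1 z))⁻¹ := by
        rw [sq]
        exact mul_le_of_le_one_left (by positivity) (inv_le_one_of_one_le₀ h2)
    _ ≤ C * zjap z ^ m := by
        rw [inv_le_iff_one_le_mul₀ h0]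
        linarith

lemma cothFun_bound : ∃ C : ℝ, ∀ z, |cothFun.1 z| ≤ C * zjap z ^ (1 : ℤ) := by
  refine ⟨1, fun z => ?_⟩
  rw [zpow_one, one_mul]
  refine Real.abs_le_sqrt ?_
  have h : cothFun.1 z ^ 2 = rsq.1 z + (sinhcSq (rsq.1 z))⁻¹ ^ 2 :=
    congrArg (fun a : smoothAlg => a.1 z) cothFun_sq
  have h2 := inv_le_one_of_one_le₀ (one_le_sinhcSq (rsq_nonneg z))
  have h3 := inv_pos.2 (sinhcSq_rsq_pos z)
  rw [h, ← rsq_val]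
  nlinarith

lemma SymbolLE.cothRem_of_cothFun {n : ℕ} (h : SymbolLE n 1 cothFun) :
    SymbolLE n (-1) cothRem := by
  refine SymbolLE.of_rsq_mul ?_
  have e : rsq * cothRem = cothFun + (-1 : smoothAlg) := by
    rw [cothFun, rsq]
    ring
  rw [e]
  exact h.add ((IsSymbol.one.neg n).mono (by norm_num))

lemma symbolLE_cothFun_and_sinhcInv_sq (n : ℕ) :
    SymbolLE n 1 cothFun ∧ ∀ m, SymbolLE n m (sinhcInv ^ 2) := by
  induction n with
  | zero => exact ⟨cothFun_bound, sinhcInv_sq_bound⟩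
  | succ n ih =>
    obtain ⟨hf, he⟩ := ih
    have hp := hf.cothRem_of_cothFun
    refine ⟨⟨cothFun_bound, fun k => ?_⟩, fun m => ⟨sinhcInv_sq_bound m, fun k => ?_⟩⟩
    · rw [pdDer_cothFun]
      have h1 : SymbolLE n (-1) (1 - cothFun * cothRem) := by
        refine SymbolLE.of_rsq_mul ?_
        have e : rsq * (1 - cothFun * cothRem)
            = cothFun + algebraMap ℝ smoothAlg (-1) * sinhcInv ^ 2 := by
          have h : cothFun = 1 + rsq * cothRem := rfl
          rw [map_neg, map_one]
          linear_combination cothFun * h - cothFun_sq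
        rw [e]
        exact hf.add (((IsSymbol.algebraMap (-1) n).mul (he 1)).mono (by norm_num))
      exact ((isSymbol_zc k n).mul h1).mono (by norm_num)
    · rw [pdDer_sinhcInv_sq, Algebra.smul_def]
      exact ((IsSymbol.algebraMap (-2) n).mul
        (((isSymbol_zc k n).mul hp).mul (he (m - 1)))).mono (by lia)

lemma isSymbol_cothFun : IsSymbol 1 cothFun := fun n => (symbolLE_cothFun_and_sinhcInv_sq n).1

lemma isSymbol_cothRem : IsSymbol (-1) cothRem := fun n => (isSymbol_cothFun n).cothRem_of_cothFun

lemma isSymbol_cothMat (j k : Fin 2) : IsSymbol 1 (cothMat j k) := by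
  have h : IsSymbol 1 (cothRem * zc j * zc k) :=
    ((isSymbol_cothRem.mul (isSymbol_zc j)).mul (isSymbol_zc k)).mono (by norm_num)
  unfold cothMat
  split_ifs
  · exact isSymbol_cothFun.sub h
  · exact (IsSymbol.zero 1).sub h

/-- The vector fields `Γ_j` preserve the symbol classes. -/
lemma IsSymbol.gammaDer {m : ℤ} {a : smoothAlg} (ha : IsSymbol m a) (j : Fin 3) :
    IsSymbol m (gammaDer j a) := by
  have key : ∀ {c : smoothAlg} (k : Fin 2), IsSymbol 1 c → IsSymbol m (c * _root_.pdDer k a) :=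
    fun k hc => (hc.mul (ha.pdDer k)).mono (by lia)
  fin_cases j
  · exact (key 0 (isSymbol_cothMat 0 0)).add (key 1 (isSymbol_cothMat 0 1))
  · exact (key 0 (isSymbol_cothMat 1 0)).add (key 1 (isSymbol_cothMat 1 1))
  · exact (key 1 (isSymbol_zc 0)).sub (key 0 (isSymbol_zc 1))

lemma isSymbol_gammaJap (j : Fin 3) : IsSymbol 0 (gammaJap j) := by
  fin_cases j
  · exact ((isSymbol_zc 0).mul isSymbol_japInv).mono (by norm_num)
  · exact ((isSymbol_zc 1).mul isSymbol_japInv).mono (by norm_num)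
  · exact IsSymbol.zero 0

/-- The symbols of order zero form a subalgebra. -/
def symbolAlg : Subalgebra ℝ smoothAlg where
  carrier := {a | IsSymbol 0 a}
  mul_mem' {a b} (ha : IsSymbol 0 a) (hb : IsSymbol 0 b) := ha.mul hb
  add_mem' {a b} (ha : IsSymbol 0 a) (hb : IsSymbol 0 b) := ha.add hb
  algebraMap_mem' c := IsSymbol.algebraMap c

lemma conjPotential_mem (κ : ℝ) : conjPotential κ ∈ symbolAlg := by
  have h : ∀ j, gammaJap j ∈ symbolAlg := isSymbol_gammaJap
  have h' : ∀ j, gammaDer j (gammaJap j) ∈ symbolAlg := fun j => (isSymbol_gammaJap j).gammaDer j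
  exact sub_mem (Subalgebra.smul_mem _ (add_mem (pow_mem (h 0) 2) (pow_mem (h 1) 2)) _)
    (Subalgebra.smul_mem _ (add_mem (h' 0) (h' 1)) _)

/-- The ring of `ℝ`-linear endomorphisms of the space of smooth functions. -/
def diffOpRing : Type := Module.End ℝ smoothAlg

instance : Ring diffOpRing := inferInstanceAs (Ring (Module.End ℝ smoothAlg))

instance : Module smoothAlg diffOpRing := inferInstanceAs (Module smoothAlg (Module.End ℝ smoothAlg))

instance : IsScalarTower smoothAlg diffOpRing diffOpRing := ⟨fun _ _ _ => rfl⟩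

/-- The endomorphism underlying an element of `diffOpRing`. -/
def diffOpRing.toEnd (T : diffOpRing) : Module.End ℝ smoothAlg := T

lemma diffOpRing.ext {T U : diffOpRing} (h : ∀ a, T.toEnd a = U.toEnd a) : T = U :=
  LinearMap.ext h

/-- The vector fields `Γ_j` as endomorphisms of the space of smooth functions. -/
def gammaEnd (j : Fin 3) : diffOpRing := (gammaDer j : Module.End ℝ smoothAlg)

lemma gammaEnd_zero_mul_one : gammaEnd 0 * gammaEnd 1 = gammaEnd 1 * gammaEnd 0 + gammaEnd 2 :=
  diffOpRing.ext gammaDer_comm_zero_one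

lemma gammaEnd_two_mul_zero : gammaEnd 2 * gammaEnd 0 = gammaEnd 0 * gammaEnd 2 - gammaEnd 1 :=
  diffOpRing.ext gammaDer_comm_two_zero

lemma gammaEnd_two_mul_one : gammaEnd 2 * gammaEnd 1 = gammaEnd 1 * gammaEnd 2 + gammaEnd 0 :=
  diffOpRing.ext gammaDer_comm_two_one

lemma gammaEnd_one_mul_zero : gammaEnd 1 * gammaEnd 0 = gammaEnd 0 * gammaEnd 1 - gammaEnd 2 := by
  rw [gammaEnd_zero_mul_one, add_sub_cancel_right]

/-- The operator `Λ₀ = Γ₁² + Γ₂² - Γ₃²` as an element of `diffOpRing`. -/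
def casimirOp : diffOpRing := casimir

/-- The first order part of `Λ` as an element of `diffOpRing`. -/
def conjOp (κ : ℝ) : diffOpRing := conjFirstOrder κ

lemma casimirOp_eq : casimirOp
    = gammaEnd 0 * gammaEnd 0 + gammaEnd 1 * gammaEnd 1 - gammaEnd 2 * gammaEnd 2 := rfl

lemma commute_casimirOp_gammaEnd (j : Fin 3) : Commute casimirOp (gammaEnd j) := by
  have h10 := gammaEnd_one_mul_zero
  have h20 := gammaEnd_two_mul_zero
  have h21 := gammaEnd_two_mul_one
  rw [casimirOp_eq]
  generalize hA : gammaEnd 0 = A at *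
  generalize hB : gammaEnd 1 = B at *
  generalize hR : gammaEnd 2 = R at *
  fin_cases j
  · change _ * gammaEnd 0 = gammaEnd 0 * _
    rw [hA]
    linear_combination (norm := noncomm_ring) B * h10 + h10 * B - R * h20 - h20 * R
  · change _ * gammaEnd 1 = gammaEnd 1 * _
    rw [hB]
    linear_combination (norm := noncomm_ring) -(A * h10) - h10 * A - R * h21 - h21 * R
  · change _ * gammaEnd 2 = gammaEnd 2 * _
    rw [hR]
    linear_combination (norm := noncomm_ring) -(A * h20) - h20 * A - B * h21 - h21 * B

/-- The composition `Γ^I` as an endomorphism of the space of smooth functions. -/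
def gammaPow (I : ℕ × ℕ × ℕ) : diffOpRing :=
  gammaEnd 0 ^ I.1 * (gammaEnd 1 ^ I.2.1 * gammaEnd 2 ^ I.2.2)

lemma commute_casimirOp_gammaPow (I : ℕ × ℕ × ℕ) : Commute casimirOp (gammaPow I) :=
  ((commute_casimirOp_gammaEnd 0).pow_right _).mul_right
    (((commute_casimirOp_gammaEnd 1).pow_right _).mul_right
      ((commute_casimirOp_gammaEnd 2).pow_right _))

lemma GammaI_coe (I : ℕ × ℕ × ℕ) (a : smoothAlg) : GammaI I a.1 = ((gammaPow I).toEnd a).1 := by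
  have h : ∀ (j : Fin 3) (n : ℕ) (b : smoothAlg),
      (GammaOp j)^[n] b.1 = ((gammaEnd j ^ n).toEnd b).1 := by
    intro j n
    induction n with
    | zero => exact fun b => rfl
    | succ n ih =>
      intro b
      rw [Function.iterate_succ_apply, GammaOp_coe, ih, pow_succ]
      rfl
  rw [GammaI, h, h, h]
  rfl

/-- The operators of the form `∑_{|J| ≤ n} h_J Γ^J` with coefficients in `S⁰`. -/
def gammaFilt (n : ℕ) : Submodule symbolAlg (diffOpRing) :=
  Submodule.span symbolAlg (gammaPow '' (multiIndices n : Set (ℕ × ℕ × ℕ)))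

lemma mem_multiIndices {n : ℕ} {J : ℕ × ℕ × ℕ} :
    J ∈ multiIndices n ↔ J.1 + J.2.1 + J.2.2 ≤ n := by
  simp only [multiIndices, Finset.mem_filter, Finset.mem_product, Finset.mem_range]
  lia

lemma gammaPow_mem {n : ℕ} {J : ℕ × ℕ × ℕ} (h : J.1 + J.2.1 + J.2.2 ≤ n) :
    gammaPow J ∈ gammaFilt n :=
  Submodule.subset_span ⟨J, mem_multiIndices.2 h, rfl⟩

lemma gammaFilt_mono {n n' : ℕ} (h : n ≤ n') : gammaFilt n ≤ gammaFilt n' :=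
  Submodule.span_mono (image_mono fun _ hJ =>
    mem_multiIndices.2 ((mem_multiIndices.1 hJ).trans h))

lemma smul_mem_gammaFilt {n : ℕ} {s : smoothAlg} {T : diffOpRing}
    (hs : s ∈ symbolAlg) (hT : T ∈ gammaFilt n) : s • T ∈ gammaFilt n :=
  Submodule.smul_mem _ (⟨s, hs⟩ : symbolAlg) hT

lemma neg_mem_gammaFilt {n : ℕ} {T : diffOpRing} (hT : T ∈ gammaFilt n) : -T ∈ gammaFilt n := by
  rw [← neg_one_smul smoothAlg T]
  exact smul_mem_gammaFilt (neg_mem (one_mem symbolAlg)) hT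

lemma sub_mem_gammaFilt {n : ℕ} {T U : diffOpRing} (hT : T ∈ gammaFilt n) (hU : U ∈ gammaFilt n) :
    T - U ∈ gammaFilt n := by
  rw [sub_eq_add_neg]
  exact add_mem hT (neg_mem_gammaFilt hU)

lemma gammaEnd_mul_smul (j : Fin 3) (s : smoothAlg) (T : diffOpRing) :
    gammaEnd j * (s • T) = s • (gammaEnd j * T) + gammaDer j s • T := by
  refine diffOpRing.ext fun a => ?_
  change gammaDer j (s * T.toEnd a) = s * gammaDer j (T.toEnd a) + gammaDer j s * T.toEnd a
  rw [Derivation.leibniz, smul_eq_mul, smul_eq_mul, mul_comm (T.toEnd a)]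

lemma gammaEnd_mul_mem_of_gammaPow {n : ℕ} {j : Fin 3}
    (h : ∀ J : ℕ × ℕ × ℕ, J.1 + J.2.1 + J.2.2 ≤ n → gammaEnd j * gammaPow J ∈ gammaFilt (n + 1))
    {T : diffOpRing} (hT : T ∈ gammaFilt n) : gammaEnd j * T ∈ gammaFilt (n + 1) := by
  induction hT using Submodule.span_induction with
  | mem T hT =>
    obtain ⟨J, hJ, rfl⟩ := hT
    exact h J (mem_multiIndices.1 hJ)
  | zero => simp
  | add T U _ _ hT hU =>
    rw [mul_add]
    exact add_mem hT hU
  | smul s T hT' hT =>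
    have e : gammaEnd j * (s • T) = s.1 • (gammaEnd j * T) + gammaDer j s.1 • T :=
      gammaEnd_mul_smul j s.1 T
    rw [e]
    exact add_mem (smul_mem_gammaFilt s.2 hT)
      (smul_mem_gammaFilt (IsSymbol.gammaDer s.2 j) (gammaFilt_mono n.le_succ hT'))

lemma gammaPow_succ (a b c : ℕ) : gammaPow (a + 1, b, c) = gammaEnd 0 * gammaPow (a, b, c) := by
  simp only [gammaPow, pow_succ', mul_assoc]

lemma gammaPow_zero_succ (b c : ℕ) : gammaPow (0, b + 1, c) = gammaEnd 1 * gammaPow (0, b, c) := by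
  simp only [gammaPow, pow_succ', mul_assoc, pow_zero, one_mul]

lemma gammaPow_zero_zero_succ (c : ℕ) : gammaPow (0, 0, c + 1) = gammaEnd 2 * gammaPow (0, 0, c) := by
  simp only [gammaPow, pow_succ', pow_zero, one_mul]

lemma gammaEnd_zero_mul_mem {n : ℕ} {T : diffOpRing} (hT : T ∈ gammaFilt n) :
    gammaEnd 0 * T ∈ gammaFilt (n + 1) := by
  refine gammaEnd_mul_mem_of_gammaPow (fun ⟨a, b, c⟩ hJ => ?_) hT
  rw [← gammaPow_succ]
  exact gammaPow_mem (by simp only at hJ ⊢; lia)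

lemma gammaEnd_one_two_mul_mem (n : ℕ) :
    (∀ T ∈ gammaFilt n, gammaEnd 1 * T ∈ gammaFilt (n + 1)) ∧
      ∀ T ∈ gammaFilt n, gammaEnd 2 * T ∈ gammaFilt (n + 1) := by
  induction n with
  | zero =>
    refine ⟨fun T hT => gammaEnd_mul_mem_of_gammaPow (fun ⟨a, b, c⟩ hJ => ?_) hT,
      fun T hT => gammaEnd_mul_mem_of_gammaPow (fun ⟨a, b, c⟩ hJ => ?_) hT⟩
    all_goals
      obtain ⟨rfl, rfl, rfl⟩ : a = 0 ∧ b = 0 ∧ c = 0 := by simp only at hJ; lia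
    · rw [← gammaPow_zero_succ]
      exact gammaPow_mem (by simp)
    · rw [← gammaPow_zero_zero_succ]
      exact gammaPow_mem (by simp)
  | succ n ih =>
    obtain ⟨ih1, ih2⟩ := ih
    have h1 : ∀ T ∈ gammaFilt (n + 1), gammaEnd 1 * T ∈ gammaFilt (n + 1 + 1) := by
      refine fun T hT => gammaEnd_mul_mem_of_gammaPow (fun ⟨a, b, c⟩ hJ => ?_) hT
      cases a with
      | zero =>
        rw [← gammaPow_zero_succ]
        exact gammaPow_mem (by simp only at hJ ⊢; lia)
      | succ a =>
        have hX : gammaPow (a, b, c) ∈ gammaFilt n := gammaPow_mem (by simp only at hJ ⊢; lia)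
        rw [gammaPow_succ, ← mul_assoc, gammaEnd_one_mul_zero, sub_mul, mul_assoc]
        exact sub_mem_gammaFilt (gammaEnd_zero_mul_mem (ih1 _ hX)) (gammaFilt_mono (by lia) (ih2 _ hX))
    refine ⟨h1, fun T hT => gammaEnd_mul_mem_of_gammaPow (fun ⟨a, b, c⟩ hJ => ?_) hT⟩
    cases a with
    | zero =>
      cases b with
      | zero =>
        rw [← gammaPow_zero_zero_succ]
        exact gammaPow_mem (by simp only at hJ ⊢; lia)
      | succ b =>
        have hX : gammaPow (0, b, c) ∈ gammaFilt n := gammaPow_mem (by simp only at hJ ⊢; lia)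
        rw [gammaPow_zero_succ, ← mul_assoc, gammaEnd_two_mul_one, add_mul, mul_assoc]
        exact add_mem (h1 _ (ih2 _ hX)) (gammaFilt_mono (by lia) (gammaEnd_zero_mul_mem hX))
    | succ a =>
      have hX : gammaPow (a, b, c) ∈ gammaFilt n := gammaPow_mem (by simp only at hJ ⊢; lia)
      rw [gammaPow_succ, ← mul_assoc, gammaEnd_two_mul_zero, sub_mul, mul_assoc]
      exact sub_mem_gammaFilt (gammaEnd_zero_mul_mem (ih2 _ hX)) (gammaFilt_mono (by lia) (ih1 _ hX))

lemma gammaEnd_mul_mem (j : Fin 3) {n : ℕ} {T : diffOpRing} (hT : T ∈ gammaFilt n) :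
    gammaEnd j * T ∈ gammaFilt (n + 1) := by
  fin_cases j
  · exact gammaEnd_zero_mul_mem hT
  · exact (gammaEnd_one_two_mul_mem n).1 T hT
  · exact (gammaEnd_one_two_mul_mem n).2 T hT

lemma commutator_gammaEnd_mul_mem (i j : Fin 3) {n : ℕ} {T : diffOpRing}
    (hT : T ∈ gammaFilt n) :
    (gammaEnd i * gammaEnd j - gammaEnd j * gammaEnd i) * T ∈ gammaFilt (n + 1) := by
  have h : ∀ k, gammaEnd k * T ∈ gammaFilt (n + 1) := fun k => gammaEnd_mul_mem k hT
  have h01 : gammaEnd 0 * gammaEnd 1 - gammaEnd 1 * gammaEnd 0 = gammaEnd 2 :=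
    sub_eq_of_eq_add' gammaEnd_zero_mul_one
  have h02 : gammaEnd 0 * gammaEnd 2 - gammaEnd 2 * gammaEnd 0 = gammaEnd 1 := by
    rw [gammaEnd_two_mul_zero, sub_sub_cancel]
  have h21 : gammaEnd 2 * gammaEnd 1 - gammaEnd 1 * gammaEnd 2 = gammaEnd 0 :=
    sub_eq_of_eq_add' gammaEnd_two_mul_one
  have hsymm : ∀ i j k, gammaEnd i * gammaEnd j - gammaEnd j * gammaEnd i = gammaEnd k →
      (gammaEnd i * gammaEnd j - gammaEnd j * gammaEnd i) * T ∈ gammaFilt (n + 1) ∧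
      (gammaEnd j * gammaEnd i - gammaEnd i * gammaEnd j) * T ∈ gammaFilt (n + 1) := by
    intro i j k e
    refine ⟨by rw [e]; exact h k, ?_⟩
    rw [← neg_sub, e, neg_mul]
    exact neg_mem_gammaFilt (h k)
  fin_cases i <;> fin_cases j
  · simp
  · exact (hsymm 0 1 2 h01).1
  · exact (hsymm 0 2 1 h02).1
  · exact (hsymm 0 1 2 h01).2
  · simp
  · exact (hsymm 2 1 0 h21).2
  · exact (hsymm 0 2 1 h02).2
  · exact (hsymm 2 1 0 h21).1
  · simp

lemma commutator_conjFirstOrder_gammaEnd_mul_mem (κ : ℝ) (i : Fin 3) {n : ℕ}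
    {T : diffOpRing} (hT : T ∈ gammaFilt n) :
    (conjOp κ * gammaEnd i - gammaEnd i * conjOp κ) * T ∈ gammaFilt (n + 1) := by
  have hsmul : ∀ (s : smoothAlg) (j : Fin 3), s ∈ symbolAlg →
      ((s • gammaEnd j) * gammaEnd i - gammaEnd i * (s • gammaEnd j)) * T ∈ gammaFilt (n + 1) := by
    intro s j hs
    have e : ((s • gammaEnd j) * gammaEnd i - gammaEnd i * (s • gammaEnd j)) * T
        = s • ((gammaEnd j * gammaEnd i - gammaEnd i * gammaEnd j) * T)
          - gammaDer i s • (gammaEnd j * T) := by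
      rw [gammaEnd_mul_smul]
      simp only [smul_mul_assoc, sub_mul, add_mul, smul_sub]
      abel
    rw [e]
    exact sub_mem_gammaFilt (smul_mem_gammaFilt hs (commutator_gammaEnd_mul_mem j i hT))
      (smul_mem_gammaFilt (IsSymbol.gammaDer hs i) (gammaEnd_mul_mem j hT))
  have hpot : ((conjPotential κ • (1 : diffOpRing)) * gammaEnd i
      - gammaEnd i * (conjPotential κ • (1 : diffOpRing))) * T
        ∈ gammaFilt (n + 1) := by
    have e : ((conjPotential κ • (1 : diffOpRing)) * gammaEnd i
        - gammaEnd i * (conjPotential κ • (1 : diffOpRing))) * T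
          = -(gammaDer i (conjPotential κ) • T) := by
      rw [gammaEnd_mul_smul]
      simp only [smul_mul_assoc, sub_mul, add_mul, one_mul, mul_one]
      abel
    rw [e]
    exact neg_mem_gammaFilt (smul_mem_gammaFilt (IsSymbol.gammaDer (conjPotential_mem κ) i)
      (gammaFilt_mono n.le_succ hT))
  have hb : ∀ j, (-2 * κ) • gammaJap j ∈ symbolAlg := fun j => (isSymbol_gammaJap j).smul _
  have e : conjOp κ = ((-2 * κ) • gammaJap 0) • gammaEnd 0
      + ((-2 * κ) • gammaJap 1) • gammaEnd 1 + conjPotential κ • (1 : diffOpRing) := rfl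
  have h := add_mem (add_mem (hsmul _ 0 (hb 0)) (hsmul _ 1 (hb 1))) hpot
  rw [e]
  convert h using 1
  rw [← add_mul, ← add_mul]
  congr 1
  simp only [mul_add, add_mul]
  abel

lemma commutator_conjFirstOrder_gammaPow_mem (κ : ℝ) (I : ℕ × ℕ × ℕ) :
    conjOp κ * gammaPow I - gammaPow I * conjOp κ
      ∈ gammaFilt (I.1 + I.2.1 + I.2.2) := by
  have step : ∀ (i : Fin 3) (k n : ℕ) (X : diffOpRing),
      X ∈ gammaFilt n ∧ conjOp κ * X - X * conjOp κ ∈ gammaFilt n →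
      gammaEnd i ^ k * X ∈ gammaFilt (k + n) ∧
        conjOp κ * (gammaEnd i ^ k * X) - gammaEnd i ^ k * X * conjOp κ
          ∈ gammaFilt (k + n) := by
    intro i k n X hX
    induction k with
    | zero => simpa using hX
    | succ k ih =>
      obtain ⟨h1, h2⟩ := ih
      rw [pow_succ', mul_assoc, show k + 1 + n = k + n + 1 by ring]
      refine ⟨gammaEnd_mul_mem i h1, ?_⟩
      have h := add_mem (commutator_conjFirstOrder_gammaEnd_mul_mem κ i h1) (gammaEnd_mul_mem i h2)
      convert h using 1
      simp only [sub_mul, mul_sub, mul_assoc]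
      abel
  have h0 : (1 : diffOpRing) ∈ gammaFilt 0 := by
    have : gammaPow (0, 0, 0) ∈ gammaFilt 0 := gammaPow_mem (by simp)
    simpa [gammaPow] using this
  have h := step 0 I.1 _ _ (step 1 I.2.1 _ _ (step 2 I.2.2 0 1 ⟨h0, by simp⟩))
  have h2 := h.2
  rw [mul_one, show I.1 + (I.2.1 + (I.2.2 + 0)) = I.1 + I.2.1 + I.2.2 by ring] at h2
  exact h2

/-- The commutator of `Γ^I` with the spatial operator `Λ`. -/
lemma exists_commutator_gammaPow (κ : ℝ) (I : ℕ × ℕ × ℕ) :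
    ∃ h : ℕ × ℕ × ℕ → smoothAlg, (∀ J, IsSymbol 0 (h J)) ∧
      gammaPow I * (casimirOp + conjOp κ) - (casimirOp + conjOp κ) * gammaPow I
        = ∑ J ∈ multiIndices (I.1 + I.2.1 + I.2.2), h J • gammaPow J := by
  have h1 := neg_mem_gammaFilt (commutator_conjFirstOrder_gammaPow_mem κ I)
  obtain ⟨c, hc⟩ := (Submodule.mem_span_image_finset_iff_exists_fun symbolAlg).1 h1
  refine ⟨fun J => if hJ : J ∈ multiIndices (I.1 + I.2.1 + I.2.2) then (c ⟨J, hJ⟩).1 else 0,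
    fun J => ?_, ?_⟩
  · beta_reduce
    split_ifs with hJ
    · exact (c ⟨J, hJ⟩).2
    · exact zero_mem symbolAlg
  · have h2 := (commute_casimirOp_gammaPow I).eq
    rw [mul_add, add_mul, h2, add_sub_add_left_eq_sub, ← neg_sub, ← hc,
      ← Finset.sum_coe_sort (multiIndices _)]
    refine Finset.sum_congr rfl fun J _ => ?_
    beta_reduce
    rw [dif_pos J.2]
    rfl

/-- The smooth functions `v(τ, z)`, curried. -/
def JointlySmooth (v : ℝ → (Fin 2 → ℝ) → ℝ) : Prop :=
  ContDiff ℝ (⊤ : ℕ∞) fun p : ℝ × (Fin 2 → ℝ) => v p.1 p.2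

/-- The derivative `∂_τ v`. -/
def timeDeriv (v : ℝ → (Fin 2 → ℝ) → ℝ) (τ : ℝ) (z : Fin 2 → ℝ) : ℝ :=
  deriv (fun σ => v σ z) τ

namespace JointlySmooth

variable {v : ℝ → (Fin 2 → ℝ) → ℝ}

lemma slice (hv : JointlySmooth v) (τ : ℝ) : ContDiff ℝ (⊤ : ℕ∞) (v τ) :=
  ContDiff.comp (g := fun p : ℝ × (Fin 2 → ℝ) => v p.1 p.2) hv
    (contDiff_const.prodMk contDiff_id)

lemma hasFDerivAt (hv : JointlySmooth v) (p : ℝ × (Fin 2 → ℝ)) :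
    HasFDerivAt (fun p : ℝ × (Fin 2 → ℝ) => v p.1 p.2)
      (fderiv ℝ (fun p : ℝ × (Fin 2 → ℝ) => v p.1 p.2) p) p :=
  (ContDiff.differentiable hv (by simp) p).hasFDerivAt

lemma hasDerivAt_time (hv : JointlySmooth v) (τ : ℝ) (z : Fin 2 → ℝ) :
    HasDerivAt (fun σ => v σ z)
      (fderiv ℝ (fun p : ℝ × (Fin 2 → ℝ) => v p.1 p.2) (τ, z) (1, 0)) τ :=
  (hv.hasFDerivAt (τ, z)).comp_hasDerivAt (f := fun σ => (σ, z)) τ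
    ((hasDerivAt_id τ).prodMk (hasDerivAt_const τ z))

lemma timeDeriv_eq (hv : JointlySmooth v) (τ : ℝ) (z : Fin 2 → ℝ) : timeDeriv v τ z
    = fderiv ℝ (fun p : ℝ × (Fin 2 → ℝ) => v p.1 p.2) (τ, z) (1, 0) :=
  (hv.hasDerivAt_time τ z).deriv

lemma pd_eq (hv : JointlySmooth v) (k : Fin 2) (τ : ℝ) (z : Fin 2 → ℝ) : pd k (v τ) z
    = fderiv ℝ (fun p : ℝ × (Fin 2 → ℝ) => v p.1 p.2) (τ, z) (0, Pi.single k 1) := by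
  have h : HasFDerivAt (v τ) _ z :=
    (hv.hasFDerivAt (τ, z)).comp z ((hasFDerivAt_const τ z).prodMk (hasFDerivAt_id z))
  rw [pd, h.fderiv]
  rfl

lemma timeDeriv (hv : JointlySmooth v) : JointlySmooth (timeDeriv v) := by
  have h : (fun p : ℝ × (Fin 2 → ℝ) => _root_.timeDeriv v p.1 p.2)
      = fun p => fderiv ℝ (fun p : ℝ × (Fin 2 → ℝ) => v p.1 p.2) p (1, 0) :=
    funext fun p => hv.timeDeriv_eq p.1 p.2
  rw [JointlySmooth, h]
  exact contDiff_fderiv_apply hv _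

lemma pd (hv : JointlySmooth v) (k : Fin 2) : JointlySmooth fun τ => pd k (v τ) := by
  have h : (fun p : ℝ × (Fin 2 → ℝ) => _root_.pd k (v p.1) p.2)
      = fun p => fderiv ℝ (fun p : ℝ × (Fin 2 → ℝ) => v p.1 p.2) p (0, Pi.single k 1) :=
    funext fun p => hv.pd_eq k p.1 p.2
  rw [JointlySmooth, h]
  exact contDiff_fderiv_apply hv _

lemma timeDeriv_pd (hv : JointlySmooth v) (k : Fin 2) :
    _root_.timeDeriv (fun τ => _root_.pd k (v τ)) = fun τ => _root_.pd k (_root_.timeDeriv v τ) := by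
  funext τ z
  have h1 : (fun p : ℝ × (Fin 2 → ℝ) => _root_.pd k (v p.1) p.2)
      = fun p => fderiv ℝ (fun p : ℝ × (Fin 2 → ℝ) => v p.1 p.2) p (0, Pi.single k 1) :=
    funext fun p => hv.pd_eq k p.1 p.2
  have h2 : (fun p : ℝ × (Fin 2 → ℝ) => _root_.timeDeriv v p.1 p.2)
      = fun p => fderiv ℝ (fun p : ℝ × (Fin 2 → ℝ) => v p.1 p.2) p (1, 0) :=
    funext fun p => hv.timeDeriv_eq p.1 p.2
  rw [(hv.pd k).timeDeriv_eq, hv.timeDeriv.pd_eq, h1, h2]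
  exact fderiv_fderiv_comm hv _ _ _

end JointlySmooth

/-- An operator in the space variables which preserves smooth functions of `(τ, z)` and commutes
with `∂_τ` on them. -/
def CommutesWithTime (T : ((Fin 2 → ℝ) → ℝ) → (Fin 2 → ℝ) → ℝ) : Prop :=
  ∀ v, JointlySmooth v → JointlySmooth (fun τ => T (v τ)) ∧
    timeDeriv (fun τ => T (v τ)) = fun τ => T (timeDeriv v τ)

lemma CommutesWithTime.comp {T U : ((Fin 2 → ℝ) → ℝ) → (Fin 2 → ℝ) → ℝ}
    (hT : CommutesWithTime T) (hU : CommutesWithTime U) : CommutesWithTime fun φ => T (U φ) := by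
  intro v hv
  obtain ⟨h1, h2⟩ := hU v hv
  obtain ⟨h3, h4⟩ := hT _ h1
  refine ⟨h3, h4.trans ?_⟩
  rw [h2]

lemma CommutesWithTime.iterate {T : ((Fin 2 → ℝ) → ℝ) → (Fin 2 → ℝ) → ℝ}
    (hT : CommutesWithTime T) (n : ℕ) : CommutesWithTime T^[n] := by
  induction n with
  | zero => exact fun v hv => ⟨hv, rfl⟩
  | succ n ih => exact ih.comp hT

lemma commutesWithTime_pd (k : Fin 2) : CommutesWithTime (pd k) :=
  fun _ hv => ⟨hv.pd k, hv.timeDeriv_pd k⟩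

lemma CommutesWithTime.smoothMul {T : ((Fin 2 → ℝ) → ℝ) → (Fin 2 → ℝ) → ℝ}
    (hT : CommutesWithTime T) (a : smoothAlg) : CommutesWithTime fun φ z => a.1 z * T φ z := by
  intro v hv
  obtain ⟨h1, h2⟩ := hT v hv
  refine ⟨((smoothAlg.contDiff a).comp contDiff_snd).mul h1, funext fun τ => funext fun z => ?_⟩
  have h3 := (h1.hasDerivAt_time τ z).differentiableAt
  have h4 := congrFun (congrFun h2 τ) z
  rw [timeDeriv] at h4 ⊢
  rw [deriv_const_mul _ h3, h4]

lemma CommutesWithTime.add {T U : ((Fin 2 → ℝ) → ℝ) → (Fin 2 → ℝ) → ℝ}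
    (hT : CommutesWithTime T) (hU : CommutesWithTime U) :
    CommutesWithTime fun φ z => T φ z + U φ z := by
  intro v hv
  obtain ⟨h1, h2⟩ := hT v hv
  obtain ⟨h3, h4⟩ := hU v hv
  refine ⟨ContDiff.add h1 h3, funext fun τ => funext fun z => ?_⟩
  have h5 := congrFun (congrFun h2 τ) z
  have h6 := congrFun (congrFun h4 τ) z
  rw [timeDeriv] at h5 h6 ⊢
  rw [deriv_fun_add (h1.hasDerivAt_time τ z).differentiableAt
    (h3.hasDerivAt_time τ z).differentiableAt, h5, h6]

lemma commutesWithTime_GammaOp (j : Fin 3) : CommutesWithTime (GammaOp j) := by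
  have h : ∀ A B : smoothAlg, CommutesWithTime fun φ z => A.1 z * pd 0 φ z + B.1 z * pd 1 φ z :=
    fun A B => ((commutesWithTime_pd 0).smoothMul A).add ((commutesWithTime_pd 1).smoothMul B)
  fin_cases j
  · convert h (cothMat 0 0) (cothMat 0 1) using 3 with φ z
    simp [GammaOp, cmat_eq, Fin.sum_univ_two]
  · convert h (cothMat 1 0) (cothMat 1 1) using 3 with φ z
    simp [GammaOp, cmat_eq, Fin.sum_univ_two]
  · convert h (-zc 1) (zc 0) using 3 with φ z
    change z 0 * pd 1 φ z - z 1 * pd 0 φ z = -z 1 * pd 0 φ z + z 0 * pd 1 φ z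
    ring

lemma commutesWithTime_GammaI (I : ℕ × ℕ × ℕ) : CommutesWithTime (GammaI I) :=
  ((commutesWithTime_GammaOp 0).iterate I.1).comp
    (((commutesWithTime_GammaOp 1).iterate I.2.1).comp
      ((commutesWithTime_GammaOp 2).iterate I.2.2))

lemma Pm_eq (m κ : ℝ) {v : ℝ → (Fin 2 → ℝ) → ℝ} (τ : ℝ) {a b : smoothAlg} (ha : v τ = a.1)
    (hb : timeDeriv (timeDeriv v) τ = b.1) :
    Pm m κ v τ = (b - (1 / τ ^ 2) • (casimirOp + conjOp κ).toEnd a + m ^ 2 • a).1 := by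
  funext z
  have h2 : iteratedDeriv 2 (fun s => v s z) τ = b.1 z := by
    rw [← hb, iteratedDeriv_succ, iteratedDeriv_one]
    rfl
  rw [Pm, h2, ha, Lam_coe]
  rfl

/-- `[P_m, Γ^I] v = τ⁻² Σ_{|J| ≤ |I|} h_{IJ}(z) Γ^J v` with `h_{IJ} ∈ S⁰`. -/
theorem commutator_Pm_GammaI (m κ : ℝ) (hm : 0 < m) (hκ : 0 < κ) (I : ℕ × ℕ × ℕ) :
    ∃ h : ℕ × ℕ × ℕ → (Fin 2 → ℝ) → ℝ,
      (∀ J ∈ multiIndices (I.1 + I.2.1 + I.2.2), MemS0 (h J)) ∧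
      ∀ v : ℝ → (Fin 2 → ℝ) → ℝ,
        ContDiff ℝ (⊤ : ℕ∞) (fun p : ℝ × (Fin 2 → ℝ) => v p.1 p.2) →
        ∀ τ : ℝ, 0 < τ → ∀ z : Fin 2 → ℝ,
          Pm m κ (fun σ => GammaI I (v σ)) τ z - GammaI I (Pm m κ v τ) z
            = (1 / τ ^ 2) * ∑ J ∈ multiIndices (I.1 + I.2.1 + I.2.2),
                h J z * GammaI J (v τ) z := by
  obtain ⟨h, hh, hc⟩ := exists_commutator_gammaPow κ I
  refine ⟨fun J => (h J).1, fun J _ => (hh J).memS0, fun v hv τ _ z => ?_⟩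
  have hv : JointlySmooth v := hv
  let a := smoothAlg.mk (v τ) (hv.slice τ)
  let b := smoothAlg.mk (timeDeriv (timeDeriv v) τ) (hv.timeDeriv.timeDeriv.slice τ)
  have h1 : timeDeriv (timeDeriv fun σ => GammaI I (v σ)) τ = ((gammaPow I).toEnd b).1 := by
    rw [(commutesWithTime_GammaI I v hv).2, (commutesWithTime_GammaI I _ hv.timeDeriv).2]
    exact GammaI_coe I b
  rw [Pm_eq m κ τ (v := v) (a := a) (b := b) rfl rfl, GammaI_coe,
    Pm_eq m κ τ (v := fun σ => GammaI I (v σ)) (GammaI_coe I a) h1, map_add, map_sub, map_smul,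
    map_smul]
  have h2 := congrArg (fun T : diffOpRing => (T.toEnd a).1 z) hc
  have h3 : ((∑ J ∈ multiIndices (I.1 + I.2.1 + I.2.2), h J • gammaPow J).toEnd a).1 z
      = ∑ J ∈ multiIndices (I.1 + I.2.1 + I.2.2), (h J).1 z * GammaI J (v τ) z := by
    let ev : diffOpRing →+ ℝ :=
      { toFun := fun T => (T.toEnd a).1 z
        map_zero' := rfl
        map_add' := fun _ _ => rfl }
    refine (map_sum ev _ _).trans (Finset.sum_congr rfl fun J _ => ?_)
    rw [show v τ = a.1 from rfl, GammaI_coe]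
    rfl
  have h4 : ((gammaPow I).toEnd ((casimirOp + conjOp κ).toEnd a)).1 z
      - ((casimirOp + conjOp κ).toEnd ((gammaPow I).toEnd a)).1 z
      = ∑ J ∈ multiIndices (I.1 + I.2.1 + I.2.2), (h J).1 z * GammaI J (v τ) z := h2.trans h3
  rw [← h4]
  change ((gammaPow I).toEnd b).1 z
      - 1 / τ ^ 2 * ((casimirOp + conjOp κ).toEnd ((gammaPow I).toEnd a)).1 z
      + m ^ 2 * ((gammaPow I).toEnd a).1 z
    - (((gammaPow I).toEnd b).1 z
      - 1 / τ ^ 2 * ((gammaPow I).toEnd ((casimirOp + conjOp κ).toEnd a)).1 z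
      + m ^ 2 * ((gammaPow I).toEnd a).1 z) = _
  ring

end
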